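/- arXiv:2405.05450 — 7 statements merged into one kernel-verified Lean document; each statement's English description precedes it below -/
import Mathlib

section
/- Let d ≥ 1 and k ≥ 1. Let I₀ = [a₀, b₀] ⊂ ℝ with a₀ < b₀, let I₁, …, I_k ⊂ ℝ be nonempty compact intervals, and for each 0 ≤ i ≤ k let Q_i: I_i → ℝ^d be continuous and injective. If Q₀(I₀) ⊆ ⋃_{i=1}^k Q_i(I_i), then there exist an index i ∈ {1, …, k} and a nonempty open interval J ⊆ I_i such that Q_i(J) ⊆ Q₀(I₀). -/
/-- If countably many closed sets cover a nondegenerate open interval, one of them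
contains a nonempty open set. -/
theorem exists_isOpen_subset_of_Ioo_subset_iUnion {ι : Type*} [Countable ι] {a b : ℝ}
    (hab : a < b) {F : ι → Set ℝ} (hF : ∀ i, IsClosed (F i)) (hcover : Set.Ioo a b ⊆ ⋃ i, F i) :
    ∃ (i : ι) (U : Set ℝ), IsOpen U ∧ U.Nonempty ∧ U ⊆ F i := by
  let G : Option ι → Set ℝ := fun o => o.elim (Set.Ioo a b)ᶜ F
  have hG : ∀ o, IsClosed (G o) := by
    rintro (_ | i)
    exacts [isOpen_Ioo.isClosed_compl, hF i]
  have hGcover : ⋃ o, G o = Set.univ := by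
    refine Set.eq_univ_of_forall fun x => ?_
    by_cases hx : x ∈ Set.Ioo a b
    · obtain ⟨i, hi⟩ := Set.mem_iUnion.1 (hcover hx)
      exact Set.mem_iUnion.2 ⟨some i, hi⟩
    · exact Set.mem_iUnion.2 ⟨none, hx⟩
  obtain ⟨x, hx, hxG⟩ := (dense_iUnion_interior_of_closed hG hGcover).inter_open_nonempty _
    isOpen_Ioo (Set.nonempty_Ioo.2 hab)
  obtain ⟨_ | i, hi⟩ := Set.mem_iUnion.1 hxG
  · exact absurd hx (interior_subset hi)
  · exact ⟨i, interior (F i), isOpen_interior, ⟨x, hi⟩, interior_subset⟩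

/-- The preimage of a preconnected subset of the image, under a continuous injective map on a
compact set, is preconnected. -/
theorem isPreconnected_inter_preimage_of_injOn {X Y : Type*} [TopologicalSpace X]
    [TopologicalSpace Y] [T2Space Y] {f : X → Y} {K : Set X} {s : Set Y}
    (hf : ContinuousOn f K) (hinj : Set.InjOn f K) (hK : IsCompact K)
    (hs : IsPreconnected s) (hsub : s ⊆ f '' K) : IsPreconnected (K ∩ f ⁻¹' s) := by
  have : CompactSpace K := isCompact_iff_compactSpace.1 hK
  have h := hs.preimage_of_isClosedMap hinj.injective hf.domRestrict.isClosedMap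
    (by rwa [Set.range_domRestrict])
  have h' := h.image _ continuous_subtype_val.continuousOn
  rwa [Set.domRestrict_eq, Set.preimage_comp, Subtype.image_preimage_coe] at h'


/-- If a continuous injective curve `Q₀` on a nondegenerate compact interval has its image
covered by the images of finitely many continuous injective curves `Q i` on compact
intervals, then some `Q i` maps a nonempty open subinterval of its domain into the image
of `Q₀`. -/
theorem stmt2 {d k : ℕ} (hd : 1 ≤ d) (hk : 1 ≤ k)
    (a₀ b₀ : ℝ) (h₀ : a₀ < b₀)
    (a b : Fin k → ℝ) (hab : ∀ i, a i ≤ b i)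
    (Q₀ : ℝ → (Fin d → ℝ)) (Q : Fin k → ℝ → (Fin d → ℝ))
    (hQ₀c : ContinuousOn Q₀ (Set.Icc a₀ b₀)) (hQ₀i : Set.InjOn Q₀ (Set.Icc a₀ b₀))
    (hQc : ∀ i, ContinuousOn (Q i) (Set.Icc (a i) (b i)))
    (hQi : ∀ i, Set.InjOn (Q i) (Set.Icc (a i) (b i)))
    (hcover : Q₀ '' Set.Icc a₀ b₀ ⊆ ⋃ i, Q i '' Set.Icc (a i) (b i)) :
    ∃ (i : Fin k) (c e : ℝ), c < e ∧ Set.Ioo c e ⊆ Set.Icc (a i) (b i) ∧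
      Q i '' Set.Ioo c e ⊆ Q₀ '' Set.Icc a₀ b₀ := by
  obtain ⟨i, c, e, hce, hsub, hcov⟩ : ∃ (i : Fin k) (c e : ℝ), c < e ∧
      Set.Icc c e ⊆ Set.Icc a₀ b₀ ∧ Q₀ '' Set.Icc c e ⊆ Q i '' Set.Icc (a i) (b i) := by
    obtain ⟨i, U, hU, ⟨x, hxU⟩, hsub⟩ := exists_isOpen_subset_of_Ioo_subset_iUnion h₀
      (fun i => hQ₀c.preimage_isClosed_of_isClosed isClosed_Icc
        (isCompact_Icc.image_of_continuousOn (hQc i)).isClosed)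
      (fun t ht => by
        have ht' := Set.Ioo_subset_Icc_self ht
        obtain ⟨i, hi⟩ := Set.mem_iUnion.1 (hcover ⟨t, ht', rfl⟩)
        exact Set.mem_iUnion.2 ⟨i, ht', hi⟩)
    obtain ⟨ε, hε, hball⟩ := Metric.nhds_basis_closedBall.mem_iff.1 (hU.mem_nhds hxU)
    rw [Real.closedBall_eq_Icc] at hball
    refine ⟨i, x - ε, x + ε, by linarith, fun t ht => (hsub (hball ht)).1, ?_⟩
    rintro _ ⟨t, ht, rfl⟩
    exact (hsub (hball ht)).2
  have hconn := isPreconnected_inter_preimage_of_injOn (hQc i) (hQi i) isCompact_Icc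
    (isPreconnected_Icc.image Q₀ (hQ₀c.mono hsub)) hcov
  have hc : c ∈ Set.Icc c e := Set.left_mem_Icc.2 hce.le
  have he : e ∈ Set.Icc c e := Set.right_mem_Icc.2 hce.le
  obtain ⟨u, hu, huc⟩ := hcov ⟨c, hc, rfl⟩
  obtain ⟨v, hv, hve⟩ := hcov ⟨e, he, rfl⟩
  have huv : u ≠ v := fun h => hce.ne (hQ₀i (hsub hc) (hsub he) (by rw [← huc, ← hve, h]))
  have hsubset := (Set.Ioo_subset_Icc_self (a := min u v) (b := max u v)).trans
    (hconn.ordConnected.uIcc_subset ⟨hu, c, hc, huc.symm⟩ ⟨hv, e, he, hve.symm⟩)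
  refine ⟨i, min u v, max u v, min_lt_max.2 huv, fun t ht => (hsubset ht).1, ?_⟩
  rintro _ ⟨t, ht, rfl⟩
  exact Set.image_mono hsub (hsubset ht).2
end

section
/- Let d ≥ 2. Let P: ℝ → M_d(ℝ) be differentiable at 0, with P(t) orthogonal for all t in a neighborhood of 0 and P(0) = I_d, and suppose P'(0) = fromBlocks(Q₀, v, −vᵀ, 0) for some Q₀ ∈ M_{d−1}(ℝ) and v ∈ ℝ^{d−1}. Let Λ: ℝ → M_d(ℝ) be differentiable at 0 with Λ(t) = fromBlocks(D(t), 0, 0, 0) where D(t) ∈ M_{d−1}(ℝ) is diagonal and D(0) = I_{d−1}. Then the curve A(t) := P(t) Λ(t) P(t)ᵀ is differentiable at 0 and A'(0) = fromBlocks(D'(0), −v, −vᵀ, 0). -/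
open Matrix

/-- A vector `v ∈ ℝ^m` regarded as a column matrix. -/
noncomputable def colV {m : ℕ} (v : Fin m → ℝ) : Matrix (Fin m) Unit ℝ :=
  Matrix.of fun i _ => v i

/-- A vector `v ∈ ℝ^m` regarded as a row matrix. -/
noncomputable def rowV {m : ℕ} (v : Fin m → ℝ) : Matrix Unit (Fin m) ℝ :=
  Matrix.of fun _ j => v j

/-- Product rule for curves of matrices, entrywise. -/
theorem hasDerivAt_matrix_mul_apply {l n o : Type*} [Fintype n] {A : ℝ → Matrix l n ℝ}
    {B : ℝ → Matrix n o ℝ} {A' : Matrix l n ℝ} {B' : Matrix n o ℝ} {x : ℝ}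
    (hA : ∀ i j, HasDerivAt (fun t => A t i j) (A' i j) x)
    (hB : ∀ i j, HasDerivAt (fun t => B t i j) (B' i j) x) (i : l) (j : o) :
    HasDerivAt (fun t => (A t * B t) i j) ((A' * B x + A x * B') i j) x := by
  simp only [Matrix.mul_apply, Matrix.add_apply, ← Finset.sum_add_distrib]
  exact HasDerivAt.fun_sum fun k _ => (hA i k).mul (hB k j)

/-- The velocity at the identity of a curve of orthogonal matrices is skew-symmetric. -/
theorem add_transpose_eq_zero_of_orthogonal_curve {n : Type*} [Fintype n] [DecidableEq n]
    {P : ℝ → Matrix n n ℝ} {P' : Matrix n n ℝ} {x : ℝ}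
    (hP : ∀ i j, HasDerivAt (fun t => P t i j) (P' i j) x)
    (horth : ∀ᶠ t in nhds x, P t * (P t)ᵀ = 1) (hPx : P x = 1) :
    P' + P'ᵀ = 0 := by
  ext i j
  have hprod := hasDerivAt_matrix_mul_apply (B := fun t => (P t)ᵀ) (B' := P'ᵀ) hP
    (fun i j => hP j i) i j
  have hconst : HasDerivAt (fun t => (P t * (P t)ᵀ) i j) 0 x :=
    (hasDerivAt_const x ((1 : Matrix n n ℝ) i j)).congr_of_eventuallyEq
      (horth.mono fun t ht => by simp only [ht])
  simpa [hPx] using hprod.unique hconst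

/-- First derivative at `0` of `A(t) = P(t) Λ(t) P(t)ᵀ` where `P` is a curve of orthogonal
matrices with `P(0) = I` and `P'(0) = fromBlocks(Q₀, v, -vᵀ, 0)`, and
`Λ(t) = fromBlocks(D(t),0,0,0)` with `D` diagonal, `D(0) = I`. Then
`A'(0) = fromBlocks(D'(0), -v, -vᵀ, 0)` (here `d = m + 1`, `d ≥ 2`). -/
theorem stmt3 {m : ℕ} (hm : 1 ≤ m)
    (P : ℝ → Matrix (Fin m ⊕ Unit) (Fin m ⊕ Unit) ℝ)
    (P' : Matrix (Fin m ⊕ Unit) (Fin m ⊕ Unit) ℝ)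
    (hP : ∀ i j, HasDerivAt (fun t : ℝ => P t i j) (P' i j) 0)
    (horth : ∀ᶠ t in nhds (0 : ℝ), P t * (P t)ᵀ = 1)
    (hP0 : P 0 = 1)
    (Q₀ : Matrix (Fin m) (Fin m) ℝ) (v : Fin m → ℝ)
    (hP' : P' = Matrix.fromBlocks Q₀ (colV v) (-(rowV v)) 0)
    (D : ℝ → Matrix (Fin m) (Fin m) ℝ)
    (D' : Matrix (Fin m) (Fin m) ℝ)
    (hD : ∀ i j, HasDerivAt (fun t : ℝ => D t i j) (D' i j) 0)
    (hDdiag : ∀ t, (D t).IsDiag)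
    (hD0 : D 0 = 1) :
    ∀ i j, HasDerivAt (fun t : ℝ => (P t * Matrix.fromBlocks (D t) 0 0 0 * (P t)ᵀ : Matrix (Fin m ⊕ Unit) (Fin m ⊕ Unit) ℝ) i j)
      (Matrix.fromBlocks D' (-(colV v)) (-(rowV v)) 0 i j) 0 := by
  have hskew := add_transpose_eq_zero_of_orthogonal_curve hP horth hP0
  have hQ : Q₀ + Q₀ᵀ = 0 := by
    ext i j
    simpa [hP'] using congrFun₂ hskew (Sum.inl i) (Sum.inl j)
  have hΛ : ∀ i j, HasDerivAt
      (fun t => (fromBlocks (D t) 0 0 0 : Matrix (Fin m ⊕ Unit) (Fin m ⊕ Unit) ℝ) i j)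
      ((fromBlocks D' 0 0 0 : Matrix (Fin m ⊕ Unit) (Fin m ⊕ Unit) ℝ) i j) 0 := by
    rintro (i | i) (j | j)
    · exact hD i j
    all_goals exact hasDerivAt_const _ _
  intro i j
  have hA := hasDerivAt_matrix_mul_apply (B := fun t => (P t)ᵀ) (B' := P'ᵀ)
    (hasDerivAt_matrix_mul_apply hP hΛ) (fun i j => hP j i) i j
  have hrow : (rowV v)ᵀ = colV v := rfl
  have hvalue : (P' * fromBlocks (D 0) 0 0 0 + P 0 * fromBlocks D' 0 0 0) * (P 0)ᵀ +
      P 0 * fromBlocks (D 0) 0 0 0 * P'ᵀ =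
      fromBlocks D' (-(colV v)) (-(rowV v)) 0 := by
    have hblock : Q₀ + D' + Q₀ᵀ = D' := by
      rw [add_right_comm, hQ, zero_add]
    simp [hP0, hD0, hP', fromBlocks_transpose, fromBlocks_multiply, fromBlocks_add, hrow, hblock]
  rwa [hvalue] at hA
end

section
/- Let d ≥ 2. Let P: ℝ → M_d(ℝ) be twice differentiable at 0, with P(t) orthogonal for all t in a neighborhood of 0 and P(0) = I_d, and suppose P'(0) = fromBlocks(Q₀, v, −vᵀ, 0) for some Q₀ ∈ M_{d−1}(ℝ) and v ∈ ℝ^{d−1}; let w ∈ ℝ^d be the last column of P''(0). Let Λ: ℝ → M_d(ℝ) be twice differentiable at 0 with Λ(t) = fromBlocks(D(t), 0, 0, 0), where D(t) ∈ M_{d−1}(ℝ) is diagonal and D(0) = I_{d−1}. Then the curve A(t) := P(t) Λ(t) P(t)ᵀ satisfies A''(0) = −(C_w + C_wᵀ) − 2·fromBlocks(vvᵀ, 0, 0, 0) + 2·fromBlocks(Q₀D'(0) − D'(0)Q₀, −D'(0)v, −vᵀD'(0), 0) + Λ''(0), where C_w ∈ M_d(ℝ) denotes the matrix whose last column equals w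 and whose all other entries are 0. -/
open Matrix

/-- The matrix whose last column is `w` and whose all other entries are `0`. -/
noncomputable def lastColMat {m : ℕ} (w : Fin m ⊕ Unit → ℝ) :
    Matrix (Fin m ⊕ Unit) (Fin m ⊕ Unit) ℝ :=
  Matrix.of fun i j => if j = Sum.inr () then w i else 0

/-- The product rule for matrix products, entrywise. -/
theorem hasDerivAt_mul_entry {l n o : Type*} [Fintype n] {A : ℝ → Matrix l n ℝ}
    {B : ℝ → Matrix n o ℝ} {A' : Matrix l n ℝ} {B' : Matrix n o ℝ} {t : ℝ}
    (hA : ∀ i j, HasDerivAt (fun s => A s i j) (A' i j) t)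
    (hB : ∀ i j, HasDerivAt (fun s => B s i j) (B' i j) t) (i : l) (j : o) :
    HasDerivAt (fun s => (A s * B s) i j) ((A' * B t + A t * B') i j) t := by
  simp only [Matrix.mul_apply, Matrix.add_apply, ← Finset.sum_add_distrib]
  exact HasDerivAt.fun_sum fun k _ => (hA i k).mul (hB k j)

/-- The derivative of a corner block embedding, entrywise. -/
theorem hasDerivAt_fromBlocks_entry {l n o q : Type*} {D : ℝ → Matrix l n ℝ}
    {D' : Matrix l n ℝ} {t : ℝ} (hD : ∀ i j, HasDerivAt (fun s => D s i j) (D' i j) t)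
    (i : l ⊕ o) (j : n ⊕ q) :
    HasDerivAt (fun s => Matrix.fromBlocks (D s) 0 0 0 i j)
      (Matrix.fromBlocks D' 0 0 0 i j) t := by
  rcases i with i | i <;> rcases j with j | j
  · exact hD i j
  all_goals exact hasDerivAt_const t (0 : ℝ)

/-- Entrywise first and second derivatives of `P * L * Pᵀ`. -/
theorem hasDerivAt_deriv_conj_entry {n : Type*} [Fintype n] {P P' L L' : ℝ → Matrix n n ℝ}
    {P'' L'' : Matrix n n ℝ} {t : ℝ}
    (hP' : ∀ᶠ s in nhds t, ∀ i j, HasDerivAt (fun r => P r i j) (P' s i j) s)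
    (hP'' : ∀ i j, HasDerivAt (fun s => P' s i j) (P'' i j) t)
    (hL' : ∀ᶠ s in nhds t, ∀ i j, HasDerivAt (fun r => L r i j) (L' s i j) s)
    (hL'' : ∀ i j, HasDerivAt (fun s => L' s i j) (L'' i j) t) :
    (∀ i j, HasDerivAt (fun s => (P s * L s * (P s)ᵀ) i j)
      (((P' t * L t + P t * L' t) * (P t)ᵀ + P t * L t * (P' t)ᵀ) i j) t) ∧
    ∀ i j, HasDerivAt (deriv fun s => (P s * L s * (P s)ᵀ) i j)
      ((P'' * L t * (P t)ᵀ + P t * L t * P''ᵀ + P t * L'' * (P t)ᵀ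
        + (2 : ℝ) • (P' t * L t * (P' t)ᵀ + P' t * L' t * (P t)ᵀ
          + P t * L' t * (P' t)ᵀ)) i j) t := by
  have first : ∀ᶠ s in nhds t, ∀ i j, HasDerivAt (fun r => (P r * L r * (P r)ᵀ) i j)
      (((P' s * L s + P s * L' s) * (P s)ᵀ + P s * L s * (P' s)ᵀ) i j) s := by
    filter_upwards [hP', hL'] with s hPs hLs
    exact hasDerivAt_mul_entry (hasDerivAt_mul_entry hPs hLs) fun i j => hPs j i
  refine ⟨first.self_of_nhds, fun i j => ?_⟩
  have hP := hP'.self_of_nhds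
  have hL := hL'.self_of_nhds
  have hPT : ∀ i j, HasDerivAt (fun s => (P s)ᵀ i j) ((P' t)ᵀ i j) t := fun i j => hP j i
  have hPT' : ∀ i j, HasDerivAt (fun s => (P' s)ᵀ i j) (P''ᵀ i j) t := fun i j => hP'' j i
  have second := (hasDerivAt_mul_entry (A := fun s => P' s * L s + P s * L' s)
      (fun i j => (hasDerivAt_mul_entry hP'' hL i j).add (hasDerivAt_mul_entry hP hL'' i j))
      hPT i j).add
    (hasDerivAt_mul_entry (hasDerivAt_mul_entry hP hL) hPT' i j)
  refine (second.congr_of_eventuallyEq ?_).congr_deriv ?_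
  · filter_upwards [first] with s hs
    exact (hs i j).deriv
  · change (((P'' * L t + P' t * L' t + (P' t * L' t + P t * L'')) * (P t)ᵀ
      + (P' t * L t + P t * L' t) * (P' t)ᵀ)
      + ((P' t * L t + P t * L' t) * (P' t)ᵀ + P t * L t * P''ᵀ)) i j = _
    refine Matrix.ext_iff.mpr ?_ i j
    simp only [Matrix.add_mul]
    module

/-- The constraints on the derivatives at a point of a curve of orthogonal matrices that passes
through the identity there. -/
theorem orthogonal_curve_constraints {n : Type*} [Fintype n] [DecidableEq n]
    {P P' : ℝ → Matrix n n ℝ} {P'' : Matrix n n ℝ} {t : ℝ}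
    (hP' : ∀ᶠ s in nhds t, ∀ i j, HasDerivAt (fun r => P r i j) (P' s i j) s)
    (hP'' : ∀ i j, HasDerivAt (fun s => P' s i j) (P'' i j) t)
    (horth : ∀ᶠ s in nhds t, P s * (P s)ᵀ = 1) (hPt : P t = 1) :
    P' t + (P' t)ᵀ = 0 ∧ P'' + P''ᵀ + (2 : ℝ) • (P' t * (P' t)ᵀ) = 0 := by
  obtain ⟨first, second⟩ := hasDerivAt_deriv_conj_entry (L := fun _ => 1) (L' := fun _ => 0)
    (L'' := 0) hP' hP'' (.of_forall fun s i j => hasDerivAt_const s _)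
    (fun i j => hasDerivAt_const t _)
  have const (i j : n) : (fun s => (P s * (1 : Matrix n n ℝ) * (P s)ᵀ) i j) =ᶠ[nhds t] fun _ =>
      (1 : Matrix n n ℝ) i j := by
    filter_upwards [horth] with s hs
    rw [Matrix.mul_one, hs]
  constructor <;> ext i j
  · have := (first i j).unique ((hasDerivAt_const t _).congr_of_eventuallyEq (const i j))
    simpa [hPt] using this
  · have := (second i j).unique
      (((hasDerivAt_const t (0 : ℝ)).congr_of_eventuallyEq
        ((const i j).deriv.trans (.of_eq (by simp)))))
    simpa [hPt] using this

/-- Second derivative at `0` of `A(t) = P(t) Λ(t) P(t)ᵀ` where `P` is a curve of orthogonal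
matrices, twice differentiable at `0`, with `P(0) = I`,
`P'(0) = fromBlocks(Q₀, v, -vᵀ, 0)`, `w` the last column of `P''(0)`, and
`Λ(t) = fromBlocks(D(t),0,0,0)` with `D` diagonal and `D(0) = I` (here `d = m+1 ≥ 2`):
`A''(0) = -(C_w + C_wᵀ) - 2 fromBlocks(vvᵀ,0,0,0)
          + 2 fromBlocks(Q₀D'(0) - D'(0)Q₀, -D'(0)v, -vᵀD'(0), 0) + Λ''(0)`. -/
theorem stmt4 {m : ℕ} (hm : 1 ≤ m)
    (P : ℝ → Matrix (Fin m ⊕ Unit) (Fin m ⊕ Unit) ℝ)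
    (P' : ℝ → Matrix (Fin m ⊕ Unit) (Fin m ⊕ Unit) ℝ)
    (P'' : Matrix (Fin m ⊕ Unit) (Fin m ⊕ Unit) ℝ)
    (hP' : ∀ᶠ t in nhds (0 : ℝ), ∀ i j, HasDerivAt (fun s : ℝ => P s i j) (P' t i j) t)
    (hP'' : ∀ i j, HasDerivAt (fun t : ℝ => P' t i j) (P'' i j) 0)
    (horth : ∀ᶠ t in nhds (0 : ℝ), P t * (P t)ᵀ = 1)
    (hP0 : P 0 = 1)
    (Q₀ : Matrix (Fin m) (Fin m) ℝ) (v : Fin m → ℝ)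
    (hP'0 : P' 0 = Matrix.fromBlocks Q₀ (colV v) (-(rowV v)) 0)
    (D : ℝ → Matrix (Fin m) (Fin m) ℝ)
    (D' : ℝ → Matrix (Fin m) (Fin m) ℝ)
    (D'' : Matrix (Fin m) (Fin m) ℝ)
    (hD' : ∀ᶠ t in nhds (0 : ℝ), ∀ i j, HasDerivAt (fun s : ℝ => D s i j) (D' t i j) t)
    (hD'' : ∀ i j, HasDerivAt (fun t : ℝ => D' t i j) (D'' i j) 0)
    (hDdiag : ∀ t, (D t).IsDiag)
    (hD0 : D 0 = 1) :
    ∀ i j, HasDerivAt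
      (deriv fun t : ℝ =>
        (P t * Matrix.fromBlocks (D t) 0 0 0 * (P t)ᵀ :
          Matrix (Fin m ⊕ Unit) (Fin m ⊕ Unit) ℝ) i j)
      ((-(lastColMat (fun i => P'' i (Sum.inr ())) + (lastColMat fun i => P'' i (Sum.inr ()))ᵀ)
          - (2 : ℝ) • Matrix.fromBlocks (colV v * rowV v) 0 0 0
          + (2 : ℝ) • Matrix.fromBlocks (Q₀ * D' 0 - D' 0 * Q₀) (-(D' 0 * colV v))
              (-(rowV v * D' 0)) 0
          + Matrix.fromBlocks D'' 0 0 0 :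
          Matrix (Fin m ⊕ Unit) (Fin m ⊕ Unit) ℝ) i j) 0 := by
  intro i j
  obtain ⟨hskew, hsecond⟩ := orthogonal_curve_constraints hP' hP'' horth hP0
  refine ((hasDerivAt_deriv_conj_entry hP' hP''
    (hD'.mono fun s hs => hasDerivAt_fromBlocks_entry hs)
    (hasDerivAt_fromBlocks_entry hD'')).2 i j).congr_deriv ?_
  have hQ : Q₀ᵀ = -Q₀ := by
    rw [hP'0, Matrix.fromBlocks_transpose, Matrix.fromBlocks_add,
      ← Matrix.fromBlocks_zero, Matrix.fromBlocks_inj] at hskew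
    exact eq_neg_of_add_eq_zero_right hskew.1
  have hcol : (colV v)ᵀ = rowV v := rfl
  have hrow : (rowV v)ᵀ = colV v := rfl
  refine Matrix.ext_iff.mpr ?_ i j
  obtain ⟨R, b, c, e, rfl⟩ : ∃ R b c e, P'' = Matrix.fromBlocks R b c e :=
    ⟨_, _, _, _, (Matrix.fromBlocks_toBlocks P'').symm⟩
  have hC : lastColMat (fun i => Matrix.fromBlocks R b c e i (Sum.inr ())) =
      Matrix.fromBlocks 0 b 0 e := by
    ext i (j | j) <;> rcases i with i | i <;> simp [lastColMat]
  rw [hC]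
  rw [hP'0] at hsecond ⊢
  simp only [hP0, hD0, Matrix.fromBlocks_transpose, Matrix.fromBlocks_multiply,
    Matrix.fromBlocks_add, Matrix.fromBlocks_smul, Matrix.fromBlocks_neg, sub_eq_add_neg,
    Matrix.transpose_one, Matrix.one_mul, Matrix.mul_one, hQ, hcol, hrow,
    Matrix.transpose_neg, Matrix.transpose_zero, Matrix.mul_zero, Matrix.zero_mul,
    Matrix.mul_neg, Matrix.neg_mul, add_zero, zero_add, neg_zero, neg_neg, smul_zero]
    at hsecond ⊢
  rw [← Matrix.fromBlocks_zero, Matrix.fromBlocks_inj] at hsecond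
  obtain ⟨h₁₁, h₁₂, h₂₁, h₂₂⟩ := hsecond
  rw [Matrix.fromBlocks_inj]
  refine ⟨?_, ?_, ?_, ?_⟩
  · linear_combination (norm := module) h₁₁
  · linear_combination (norm := module) h₁₂
  · linear_combination (norm := module) h₂₁
  · linear_combination (norm := module) h₂₂
end

section
/- Let n ≥ 1, let K: ℝⁿ × ℝⁿ → ℝ be differentiable and positively 2-homogeneous in its second variable (K(q, λp) = λ² K(q,p) for all λ > 0), let U: ℝⁿ → ℝ be differentiable, and let k ∈ ℝ satisfy U(q) < k for all q ∈ ℝⁿ. Set H := K + U and K̃(q,p) := K(q,p)/(k − U(q)). Then: (i) for all (q,p), H(q,p) = k if and only if K̃(q,p) = 1; (ii) for every (q,p) with H(q,p) = k, one has ∂_q K̃(q,p) = (k − U(q))⁻¹ ∂_q H(q,p) and ∂_p K̃(q,p) = (k − U(q))⁻¹ ∂_p H(q,p); in particular, on the level set {H = k} the Hamiltonian vector field of K̃ equals (k − U(q))⁻¹ times the Hamiltonian vector field of H. -/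
/-- On the level set `{f + U = k}` the derivative of `f / (k - U)` is `(k - U)⁻¹` times that of
`f + U`. -/
theorem fderiv_div_const_sub_of_add_eq {E : Type*} [NormedAddCommGroup E] [NormedSpace ℝ E]
    {f U : E → ℝ} {k : ℝ} {x : E} (hf : DifferentiableAt ℝ f x) (hU : DifferentiableAt ℝ U x)
    (hx : f x + U x = k) (hk : U x ≠ k) :
    fderiv ℝ (fun y => f y / (k - U y)) x = (k - U x)⁻¹ • fderiv ℝ (fun y => f y + U y) x := by
  have h0 : k - U x ≠ 0 := sub_ne_zero.mpr hk.symm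
  have hfx : f x = k - U x := by linarith
  have hinv : HasFDerivAt (fun y => (k - U y)⁻¹) (-((k - U x) ^ 2)⁻¹ • -fderiv ℝ U x) x :=
    (hasDerivAt_inv h0).comp_hasFDerivAt x (hU.hasFDerivAt.const_sub k)
  simp only [div_eq_mul_inv]
  rw [(hf.hasFDerivAt.fun_mul hinv).fderiv, (hf.hasFDerivAt.fun_add hU.hasFDerivAt).fderiv]
  ext v
  simp [hfx]
  field_simp
  ring


/-- Maupertuis principle: for `K` differentiable and positively 2-homogeneous in `p`,
`U` differentiable with `U < k`, and `H = K + U`, `K̃ = K/(k - U)`: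
(i) `{H = k} = {K̃ = 1}`; (ii) on `{H = k}`, the partial gradients of `K̃` equal
`(k - U(q))⁻¹` times those of `H`, so the Hamiltonian vector field of `K̃` is the time
change `(k - U(q))⁻¹ X_H` there. -/
theorem stmt8 {n : ℕ} (hn : 1 ≤ n)
    (K : (Fin n → ℝ) → (Fin n → ℝ) → ℝ) (U : (Fin n → ℝ) → ℝ) (k : ℝ)
    (hK : Differentiable ℝ (fun x : (Fin n → ℝ) × (Fin n → ℝ) => K x.1 x.2))
    (hhom : ∀ q p : Fin n → ℝ, ∀ l : ℝ, 0 < l → K q (l • p) = l ^ 2 * K q p)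
    (hU : Differentiable ℝ U)
    (hk : ∀ q, U q < k) :
    (∀ q p : Fin n → ℝ, K q p + U q = k ↔ K q p / (k - U q) = 1) ∧
    (∀ q p : Fin n → ℝ, K q p + U q = k →
      (∀ i, fderiv ℝ (fun q' => K q' p / (k - U q')) q (Pi.single i 1)
          = (k - U q)⁻¹ * fderiv ℝ (fun q' => K q' p + U q') q (Pi.single i 1)) ∧
      (∀ i, fderiv ℝ (fun p' => K q p' / (k - U q)) p (Pi.single i 1)
          = (k - U q)⁻¹ * fderiv ℝ (fun p' => K q p' + U q) p (Pi.single i 1))) := by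
  have h0 : ∀ q, k - U q ≠ 0 := fun q => (sub_pos.mpr (hk q)).ne'
  refine ⟨fun q p => ?_, fun q p hqp => ⟨fun i => ?_, fun i => ?_⟩⟩
  · rw [div_eq_one_iff_eq (h0 q), eq_sub_iff_add_eq]
  · have hKq : Differentiable ℝ (fun q' => K q' p) :=
      hK.comp (differentiable_id.prodMk (differentiable_const p))
    rw [fderiv_div_const_sub_of_add_eq (hKq q) (hU q) hqp (hk q).ne]
    rfl
  · have hKp : Differentiable ℝ (fun p' => K q p') :=
      hK.comp ((differentiable_const q).prodMk differentiable_id)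
    rw [fderiv_div_const_sub_of_add_eq (U := fun _ => U q) (hKp p)
      (differentiableAt_const _) hqp (hk q).ne]
    rfl
end

section
/- Let n ≥ 1 and let H: ℝⁿ × ℝⁿ → ℝ be C² and reversible, i.e. H(q, −p) = H(q, p) for all (q,p). Let θ = (Q, P): ℝ → ℝⁿ × ℝⁿ be a solution of Hamilton's equations Q̇ = ∂_p H(Q,P), Ṗ = −∂_q H(Q,P), and suppose the image of θ equals the image of its time reversal t ↦ (Q(−t), −P(−t)). Then there exists t₀ ∈ ℝ with P(t₀) = 0. Consequently, if the energy k := H(Q(0), P(0)) satisfies H(q, 0) ≠ k for all q ∈ ℝⁿ (for instance if k > sup_q H(q,0)), then no such solution exists. -/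
/-- Two integral curves of a locally Lipschitz autonomous vector field that agree at one time
agree at all times. -/
theorem LocallyLipschitz.integralCurve_unique {E : Type*} [NormedAddCommGroup E]
    [NormedSpace ℝ E] {v : E → E} (hv : LocallyLipschitz v) {f g : ℝ → E}
    (hf : ∀ t, HasDerivAt f (v (f t)) t) (hg : ∀ t, HasDerivAt g (v (g t)) t)
    {t₀ : ℝ} (h : f t₀ = g t₀) : f = g := by
  have hfc : Continuous f := continuous_iff_continuousAt.2 fun t => (hf t).continuousAt
  have hgc : Continuous g := continuous_iff_continuousAt.2 fun t => (hg t).continuousAt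
  ext t
  obtain ⟨a, b, ht, ht₀⟩ : ∃ a b, t ∈ Set.Ioo a b ∧ t₀ ∈ Set.Ioo a b :=
    ⟨min t t₀ - 1, max t t₀ + 1, by grind⟩
  obtain ⟨K, hK⟩ := (hv.locallyLipschitzOn (s := f '' Set.Icc a b ∪ g '' Set.Icc a b)
    ).exists_lipschitzOnWith_of_compact
      ((isCompact_Icc.image hfc).union (isCompact_Icc.image hgc))
  exact ODE_solution_unique_of_mem_Ioo (v := fun _ => v) (fun _ _ => hK) ht₀
    (fun s hs => ⟨hf s, .inl ⟨s, Set.Ioo_subset_Icc_self hs, rfl⟩⟩)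
    (fun s hs => ⟨hg s, .inr ⟨s, Set.Ioo_subset_Icc_self hs, rfl⟩⟩) h ht

section Hamiltonian

variable {n : ℕ} {F : (Fin n → ℝ) × (Fin n → ℝ) → ℝ}

/-- The Hamiltonian vector field `(∂_p F, -∂_q F)` of `F`. -/
noncomputable def hamiltonianField (F : (Fin n → ℝ) × (Fin n → ℝ) → ℝ)
    (x : (Fin n → ℝ) × (Fin n → ℝ)) : (Fin n → ℝ) × (Fin n → ℝ) :=
  (fun i => fderiv ℝ F x (0, Pi.single i 1), fun i => -fderiv ℝ F x (Pi.single i 1, 0))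

theorem contDiff_hamiltonianField (hF : ContDiff ℝ 2 F) :
    ContDiff ℝ 1 (hamiltonianField F) := by
  have h : ContDiff ℝ 1 (fderiv ℝ F) := hF.fderiv_right (by norm_num)
  exact .prodMk (contDiff_pi.2 fun i => h.clm_apply contDiff_const)
    (contDiff_pi.2 fun i => (h.clm_apply contDiff_const).neg)

theorem fderiv_hamiltonianField (x : (Fin n → ℝ) × (Fin n → ℝ)) :
    fderiv ℝ F x (hamiltonianField F x) = 0 := by
  set L := fderiv ℝ F x with hL
  have hs (i : Fin n) : (fun j => if i = j then (1 : ℝ) else 0) = Pi.single i 1 := by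
    ext j
    simp [Pi.single_apply, eq_comm]
  have hq (w : Fin n → ℝ) : L (w, 0) = ∑ i, w i * L (Pi.single i 1, 0) := by
    have := (L.comp (.inl ℝ _ _)).toLinearMap.pi_apply_eq_sum_univ w
    simpa [hs] using this
  have hp (w : Fin n → ℝ) : L (0, w) = ∑ i, w i * L (0, Pi.single i 1) := by
    have := (L.comp (.inr ℝ _ _)).toLinearMap.pi_apply_eq_sum_univ w
    simpa [hs] using this
  have hsplit (a b : Fin n → ℝ) : L (a, b) = L (a, 0) + L (0, b) := by
    rw [← map_add]; simp
  rw [hamiltonianField, ← hL, hsplit, hq, hp, ← Finset.sum_add_distrib]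
  exact Finset.sum_eq_zero fun i _ => by ring

/-- The Hamiltonian is conserved along integral curves of its Hamiltonian vector field. -/
theorem hamiltonian_conserved (hF : Differentiable ℝ F) {θ : ℝ → (Fin n → ℝ) × (Fin n → ℝ)}
    (hθ : ∀ t, HasDerivAt θ (hamiltonianField F (θ t)) t) (s t : ℝ) : F (θ s) = F (θ t) := by
  have h (t : ℝ) : HasDerivAt (F ∘ θ) 0 t := by
    simpa [fderiv_hamiltonianField] using (hF (θ t)).hasFDerivAt.comp_hasDerivAt t (hθ t)
  exact is_const_of_deriv_eq_zero (fun t => (h t).differentiableAt) (fun t => (h t).deriv) s t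

theorem hamiltonianField_reversal (hF : Differentiable ℝ F) (hrev : ∀ q p, F (q, -p) = F (q, p))
    (q p : Fin n → ℝ) :
    hamiltonianField F (q, -p) =
      (-(hamiltonianField F (q, p)).1, (hamiltonianField F (q, p)).2) := by
  let ρ : (Fin n → ℝ) × (Fin n → ℝ) →L[ℝ] (Fin n → ℝ) × (Fin n → ℝ) :=
    (ContinuousLinearMap.fst ℝ _ _).prod (-ContinuousLinearMap.snd ℝ _ _)
  have hρ : F ∘ ρ = F := funext fun x => hrev x.1 x.2
  have h : fderiv ℝ F (q, p) = (fderiv ℝ F (q, -p)).comp ρ := by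
    have := (hF (ρ (q, p))).hasFDerivAt.comp (q, p) ρ.hasFDerivAt
    rw [hρ] at this
    exact this.fderiv
  have hneg (w : Fin n → ℝ) :
      fderiv ℝ F (q, -p) (0, -w) = -fderiv ℝ F (q, -p) (0, w) := by
    rw [← map_neg]; simp
  ext i <;> simp [hamiltonianField, h, ρ, hneg]

/-- The time reversal of a solution of a reversible Hamiltonian system, with a shift of time,
is again a solution. -/
theorem hasDerivAt_timeReversal (hF : Differentiable ℝ F)
    (hrev : ∀ q p, F (q, -p) = F (q, p)) {θ : ℝ → (Fin n → ℝ) × (Fin n → ℝ)}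
    (hθ : ∀ t, HasDerivAt θ (hamiltonianField F (θ t)) t) (τ t : ℝ) :
    HasDerivAt (fun s => ((θ (τ - s)).1, -(θ (τ - s)).2))
      (hamiltonianField F ((θ (τ - t)).1, -(θ (τ - t)).2)) t := by
  have h := (hθ (τ - t)).scomp t ((hasDerivAt_id t).const_sub τ)
  have h₁ := (ContinuousLinearMap.fst ℝ (Fin n → ℝ) (Fin n → ℝ)).hasFDerivAt.comp_hasDerivAt t h
  have h₂ := (ContinuousLinearMap.snd ℝ (Fin n → ℝ) (Fin n → ℝ)).hasFDerivAt.comp_hasDerivAt t h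
  rw [hamiltonianField_reversal hF hrev]
  simpa [Function.comp_def] using h₁.prodMk h₂.neg

end Hamiltonian


/-- A reversible orbit of a reversible `C²` Hamiltonian (an orbit whose image coincides
with the image of its time reversal) must cross the zero section: `P(t₀) = 0` for some
`t₀`. Consequently, if `H(q,0) ≠ k := H(Q(0),P(0))` for every `q` (e.g. on a supercritical
energy level), no such orbit exists. -/
theorem stmt9 {n : ℕ} (hn : 1 ≤ n)
    (H : (Fin n → ℝ) → (Fin n → ℝ) → ℝ)
    (hH : ContDiff ℝ 2 (fun x : (Fin n → ℝ) × (Fin n → ℝ) => H x.1 x.2))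
    (hrev : ∀ q p : Fin n → ℝ, H q (-p) = H q p)
    (Q P : ℝ → (Fin n → ℝ))
    (hQ : ∀ t : ℝ, ∀ i, HasDerivAt (fun s : ℝ => Q s i)
        (fderiv ℝ (fun p' => H (Q t) p') (P t) (Pi.single i 1)) t)
    (hP : ∀ t : ℝ, ∀ i, HasDerivAt (fun s : ℝ => P s i)
        (-(fderiv ℝ (fun q' => H q' (P t)) (Q t) (Pi.single i 1))) t)
    (hsym : Set.range (fun t : ℝ => (Q t, P t))
        = Set.range (fun t : ℝ => (Q (-t), -P (-t)))) :
    (∃ t₀ : ℝ, P t₀ = 0) ∧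
    ((∀ q : Fin n → ℝ, H q 0 ≠ H (Q 0) (P 0)) → False) := by
  set F : (Fin n → ℝ) × (Fin n → ℝ) → ℝ := fun x => H x.1 x.2 with hFdef
  have hF : Differentiable ℝ F := hH.differentiable (by norm_num)
  have hθ (t : ℝ) : HasDerivAt (fun s => (Q s, P s)) (hamiltonianField F (Q t, P t)) t := by
    refine .prodMk (hasDerivAt_pi.2 fun i => ?_) (hasDerivAt_pi.2 fun i => ?_)
    · have h := (hF (Q t, P t)).hasFDerivAt.comp (P t) (f := fun p => (Q t, p))
        (hasFDerivAt_prodMk_right (Q t) (P t))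
      have h' : fderiv ℝ (fun p' => H (Q t) p') (P t) = _ := h.fderiv
      simpa [h'] using hQ t i
    · have h := (hF (Q t, P t)).hasFDerivAt.comp (Q t) (f := fun q => (q, P t))
        (hasFDerivAt_prodMk_left (Q t) (P t))
      have h' : fderiv ℝ (fun q' => H q' (P t)) (Q t) = _ := h.fderiv
      simpa [h'] using hP t i
  obtain ⟨t₀, ht₀⟩ : ∃ t₀, P t₀ = 0 := by
    obtain ⟨s, hs⟩ : (Q 0, P 0) ∈ Set.range (fun t : ℝ => (Q (-t), -P (-t))) :=
      hsym ▸ ⟨0, rfl⟩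
    have heq := (contDiff_hamiltonianField hH).locallyLipschitz.integralCurve_unique hθ
      (hasDerivAt_timeReversal hF hrev hθ (-s)) (t₀ := 0) (by simpa using hs.symm)
    have hmid := congrArg Prod.snd (congrFun heq (-s / 2))
    refine ⟨-s / 2, self_eq_neg.1 ?_⟩
    simpa only [sub_half] using hmid
  refine ⟨⟨t₀, ht₀⟩, fun hk => hk (Q t₀) ?_⟩
  simpa [hFdef, ht₀] using hamiltonian_conserved hF hθ t₀ 0
end

section
/- Let d ≥ 2. Let P: ℝ → M_d(ℝ) be twice differentiable, with P(t) orthogonal for all t in a neighborhood of 0, P(0) = I_d, and P'(0) = fromBlocks(Q₀, v, −vᵀ, 0) with Q₀ ∈ M_{d−1}(ℝ) (necessarily skew-symmetric) and v ∈ ℝ^{d−1}; let w' ∈ ℝ^d denote the last column of P''(0). Let D₀: ℝ → M_{d−1}(ℝ) be twice differentiable with D₀(t) diagonal and D₀(0) = I_{d−1}, let μ ∈ ℝ^{d−1}, set Γ := diag(μ₁,…,μ_{d−1}) and α := 2vvᵀ − 2(Q₀Γ − ΓQ₀) − D₀''(0). Define A(t) := P(t) · fromBlocks(D₀(t) + t(Γ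 − D₀'(0)) + (t²/2)α, 0, 0, 0) · P(t)ᵀ. Then A'(0) = fromBlocks(Γ, −v, −vᵀ, 0) and A''(0) = −(C_{w'} + C_{w'}ᵀ) − 2·fromBlocks(0, Γv, (Γv)ᵀ, 0), where C_{w'} ∈ M_d(ℝ) is the matrix whose last column is w' and whose all other entries are 0. -/
open Matrix

/-- `F` has entrywise derivative `F'` at `t`. -/
def HasEntryDerivAt {ι κ : Type*} (F : ℝ → Matrix ι κ ℝ) (F' : Matrix ι κ ℝ) (t : ℝ) : Prop :=
  ∀ i j, HasDerivAt (fun s : ℝ => F s i j) (F' i j) t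

namespace HasEntryDerivAt

variable {ι κ l : Type*} {t : ℝ}

theorem add {F G : ℝ → Matrix ι κ ℝ} {F' G' : Matrix ι κ ℝ} (hF : HasEntryDerivAt F F' t)
    (hG : HasEntryDerivAt G G' t) : HasEntryDerivAt (fun s => F s + G s) (F' + G') t :=
  fun i j => (hF i j).add (hG i j)

theorem add_const {F : ℝ → Matrix ι κ ℝ} {F' : Matrix ι κ ℝ} (hF : HasEntryDerivAt F F' t)
    (C : Matrix ι κ ℝ) : HasEntryDerivAt (fun s => F s + C) F' t :=
  fun i j => (hF i j).add_const (C i j)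

theorem smul_const {f : ℝ → ℝ} {f' : ℝ} (hf : HasDerivAt f f' t) (C : Matrix ι κ ℝ) :
    HasEntryDerivAt (fun s => f s • C) (f' • C) t :=
  fun i j => hf.mul_const (C i j)

theorem transpose {F : ℝ → Matrix ι κ ℝ} {F' : Matrix ι κ ℝ} (hF : HasEntryDerivAt F F' t) :
    HasEntryDerivAt (fun s => (F s)ᵀ) F'ᵀ t :=
  fun i j => hF j i

theorem mul [Fintype κ] {F : ℝ → Matrix ι κ ℝ} {G : ℝ → Matrix κ l ℝ} {F' : Matrix ι κ ℝ}
    {G' : Matrix κ l ℝ} (hF : HasEntryDerivAt F F' t) (hG : HasEntryDerivAt G G' t) :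
    HasEntryDerivAt (fun s => F s * G s) (F' * G t + F t * G') t := by
  intro i j
  simp only [Matrix.add_apply, Matrix.mul_apply, ← Finset.sum_add_distrib]
  exact HasDerivAt.fun_sum fun k _ => (hF i k).mul (hG k j)

theorem fromBlocks_zero {F : ℝ → Matrix ι κ ℝ} {F' : Matrix ι κ ℝ}
    (hF : HasEntryDerivAt F F' t) :
    HasEntryDerivAt (fun s => (fromBlocks (F s) 0 0 0 : Matrix (ι ⊕ l) (κ ⊕ l) ℝ))
      (fromBlocks F' 0 0 0) t := by
  rintro (i | i) (j | j)
  · exact hF i j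
  all_goals exact hasDerivAt_const t (0 : ℝ)

theorem unique {F : ℝ → Matrix ι κ ℝ} {F' G' : Matrix ι κ ℝ} (hF : HasEntryDerivAt F F' t)
    (hG : HasEntryDerivAt F G' t) : F' = G' :=
  Matrix.ext fun i j => (hF i j).unique (hG i j)

theorem eq_zero_of_eventuallyEq_const {F : ℝ → Matrix ι κ ℝ} {F' C : Matrix ι κ ℝ}
    (hF : HasEntryDerivAt F F' t) (h : ∀ᶠ s in nhds t, F s = C) : F' = 0 :=
  hF.unique fun i j => (hasDerivAt_const t (C i j)).congr_of_eventuallyEq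
    (h.mono fun _ hs => congrFun (congrFun hs i) j)

/-- Differentiating `P Pᵀ = 1` twice. -/
theorem second_deriv_orthogonal [Fintype ι] [DecidableEq ι] {P P' : ℝ → Matrix ι ι ℝ}
    {P'' : Matrix ι ι ℝ} (hP : ∀ s, HasEntryDerivAt P (P' s) s) (hP' : HasEntryDerivAt P' P'' t)
    (horth : ∀ᶠ s in nhds t, P s * (P s)ᵀ = 1) :
    P'' * (P t)ᵀ + P' t * (P' t)ᵀ + (P' t * (P' t)ᵀ + P t * P''ᵀ) = 0 := by
  have first : ∀ᶠ s in nhds t, P' s * (P s)ᵀ + P s * (P' s)ᵀ = 0 :=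
    horth.eventually_nhds.mono fun s hs =>
      ((hP s).mul (hP s).transpose).eq_zero_of_eventuallyEq_const hs
  exact ((hP'.mul (hP t).transpose).add
    ((hP t).mul hP'.transpose)).eq_zero_of_eventuallyEq_const first

end HasEntryDerivAt

theorem lastColMat_eq_mul {m : ℕ} (B : Matrix (Fin m ⊕ Unit) (Fin m ⊕ Unit) ℝ) :
    lastColMat (fun i => B i (Sum.inr ())) = B * fromBlocks 0 0 0 1 := by
  ext i (j | j) <;> simp [lastColMat, Matrix.mul_apply, Fintype.sum_sum_type]

theorem transpose_colV {m : ℕ} (v : Fin m → ℝ) : (colV v)ᵀ = rowV v := rfl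

theorem transpose_rowV {m : ℕ} (v : Fin m → ℝ) : (rowV v)ᵀ = colV v := rfl

/-- Second-order normalization of the parametric family of Hessian curves: with `P` a twice
differentiable curve of orthogonal matrices, `P(0) = I`, `P'(0) = fromBlocks(Q₀,v,-vᵀ,0)`,
`w'` the last column of `P''(0)`, `D₀` twice differentiable diagonal with `D₀(0) = I`,
`Γ = diag(μ)`, `α = 2vvᵀ - 2(Q₀Γ - ΓQ₀) - D₀''(0)`, and
`A(t) = P(t)·fromBlocks(D₀(t) + t(Γ - D₀'(0)) + (t²/2)α, 0,0,0)·P(t)ᵀ`, one has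
`A'(0) = fromBlocks(Γ,-v,-vᵀ,0)` and
`A''(0) = -(C_{w'} + C_{w'}ᵀ) - 2·fromBlocks(0, Γv, (Γv)ᵀ, 0)` (here `d = m+1 ≥ 2`). -/
theorem stmt12 {m : ℕ} (hm : 1 ≤ m)
    (P : ℝ → Matrix (Fin m ⊕ Unit) (Fin m ⊕ Unit) ℝ)
    (P' : ℝ → Matrix (Fin m ⊕ Unit) (Fin m ⊕ Unit) ℝ)
    (P'' : Matrix (Fin m ⊕ Unit) (Fin m ⊕ Unit) ℝ)
    (hP' : ∀ t : ℝ, ∀ i j, HasDerivAt (fun s : ℝ => P s i j) (P' t i j) t)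
    (hP'' : ∀ i j, HasDerivAt (fun t : ℝ => P' t i j) (P'' i j) 0)
    (horth : ∀ᶠ t in nhds (0 : ℝ), P t * (P t)ᵀ = 1)
    (hP0 : P 0 = 1)
    (Q₀ : Matrix (Fin m) (Fin m) ℝ) (v : Fin m → ℝ)
    (hP'0 : P' 0 = Matrix.fromBlocks Q₀ (colV v) (-(rowV v)) 0)
    (D₀ : ℝ → Matrix (Fin m) (Fin m) ℝ)
    (D₀' : ℝ → Matrix (Fin m) (Fin m) ℝ)
    (D₀'' : Matrix (Fin m) (Fin m) ℝ)
    (hD₀' : ∀ t : ℝ, ∀ i j, HasDerivAt (fun s : ℝ => D₀ s i j) (D₀' t i j) t)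
    (hD₀'' : ∀ i j, HasDerivAt (fun t : ℝ => D₀' t i j) (D₀'' i j) 0)
    (hDdiag : ∀ t, (D₀ t).IsDiag)
    (hD0 : D₀ 0 = 1)
    (μ : Fin m → ℝ)
    (Γ : Matrix (Fin m) (Fin m) ℝ) (hΓ : Γ = Matrix.diagonal μ)
    (α : Matrix (Fin m) (Fin m) ℝ)
    (hα : α = (2 : ℝ) • (colV v * rowV v) - (2 : ℝ) • (Q₀ * Γ - Γ * Q₀) - D₀'')
    (A : ℝ → Matrix (Fin m ⊕ Unit) (Fin m ⊕ Unit) ℝ)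
    (hA : ∀ t : ℝ, A t = P t *
        Matrix.fromBlocks (D₀ t + t • (Γ - D₀' 0) + (t ^ 2 / 2) • α) 0 0 0 * (P t)ᵀ)
    (w' : Fin m ⊕ Unit → ℝ) (hw' : w' = fun i => P'' i (Sum.inr ())) :
    (∀ i j, HasDerivAt (fun t : ℝ => A t i j)
      ((Matrix.fromBlocks Γ (-(colV v)) (-(rowV v)) 0 :
          Matrix (Fin m ⊕ Unit) (Fin m ⊕ Unit) ℝ) i j) 0) ∧
    (∀ i j, HasDerivAt (deriv fun t : ℝ => A t i j)
      ((-(lastColMat w' + (lastColMat w')ᵀ)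
          - (2 : ℝ) • Matrix.fromBlocks 0 (Γ * colV v) (Γ * colV v)ᵀ 0 :
          Matrix (Fin m ⊕ Unit) (Fin m ⊕ Unit) ℝ) i j) 0) := by
  have orth2 := HasEntryDerivAt.second_deriv_orthogonal hP' hP'' horth |>.trans fromBlocks_zero.symm
  have orth1 : P' 0 * (P 0)ᵀ + P 0 * (P' 0)ᵀ = 0 :=
    (HasEntryDerivAt.mul (hP' 0) (HasEntryDerivAt.transpose (hP' 0))).eq_zero_of_eventuallyEq_const
      horth
  have hQ : Q₀ᵀ = -Q₀ := by
    have h := congrArg toBlocks₁₁ orth1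
    simp only [hP0, hP'0, transpose_one, mul_one, one_mul, fromBlocks_transpose, fromBlocks_add,
      toBlocks_fromBlocks₁₁] at h
    rw [eq_neg_iff_add_eq_zero, add_comm, h]
    rfl
  set M : ℝ → Matrix (Fin m ⊕ Unit) (Fin m ⊕ Unit) ℝ := fun t =>
    fromBlocks (D₀ t + t • (Γ - D₀' 0) + (t ^ 2 / 2) • α) 0 0 0 with hM
  set M' : ℝ → Matrix (Fin m ⊕ Unit) (Fin m ⊕ Unit) ℝ := fun t =>
    fromBlocks (D₀' t + (Γ - D₀' 0) + t • α) 0 0 0 with hM'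
  have hMd (t : ℝ) : HasEntryDerivAt M (M' t) t := by
    refine HasEntryDerivAt.fromBlocks_zero (((HasEntryDerivAt.add (hD₀' t) ?_)).add
      (HasEntryDerivAt.smul_const ?_ α))
    · simpa using HasEntryDerivAt.smul_const (hasDerivAt_id t) (Γ - D₀' 0)
    · simpa using (hasDerivAt_pow 2 t).div_const 2
  have hMd' : HasEntryDerivAt M' (fromBlocks (D₀'' + α) 0 0 0) 0 := by
    refine HasEntryDerivAt.fromBlocks_zero ((HasEntryDerivAt.add_const hD₀'' _).add ?_)
    simpa using HasEntryDerivAt.smul_const (hasDerivAt_id (0 : ℝ)) α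
  have hPd (t : ℝ) : HasEntryDerivAt P (P' t) t := hP' t
  have hPd' : HasEntryDerivAt P' P'' 0 := hP''
  obtain rfl : A = fun t => P t * M t * (P t)ᵀ := funext hA
  have hAd (t : ℝ) := ((hPd t).mul (hMd t)).mul (hPd t).transpose
  have hAd' := (((hPd'.mul (hMd 0)).add ((hPd 0).mul hMd')).mul (hPd 0).transpose).add
    (((hPd 0).mul (hMd 0)).mul hPd'.transpose)
  have hM0 : M 0 = fromBlocks 1 0 0 0 := by simp [hM, hD0]
  have hM'0 : M' 0 = fromBlocks Γ 0 0 0 := by simp [hM']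
  have hΓT : Γᵀ = Γ := by rw [hΓ, diagonal_transpose]
  refine ⟨fun i j => ?_, fun i j => ?_⟩
  · convert hAd 0 i j using 2
    simp only [hP0, hM0, hM'0, hP'0, hQ, transpose_one, mul_one, one_mul, fromBlocks_transpose,
      fromBlocks_multiply, fromBlocks_add, transpose_neg, transpose_rowV, transpose_colV,
      transpose_zero, Matrix.mul_zero, Matrix.zero_mul, Matrix.mul_one, Matrix.one_mul, add_zero,
      zero_add, Matrix.mul_neg, neg_zero, add_neg_cancel_comm]
  · have hderiv : (deriv fun t => (P t * M t * (P t)ᵀ) i j) =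
        fun t => ((P' t * M t + P t * M' t) * (P t)ᵀ + P t * M t * (P' t)ᵀ) i j :=
      funext fun t => (hAd t i j).deriv
    rw [hderiv]
    convert hAd' i j using 2
    have hC : lastColMat w' = P'' * fromBlocks 0 0 0 1 := by rw [hw', lastColMat_eq_mul]
    obtain ⟨a, b, c, e, rfl⟩ : ∃ a b c e, P'' = fromBlocks a b c e :=
      ⟨_, _, _, _, (fromBlocks_toBlocks P'').symm⟩
    rw [hC, hM0, hM'0, hP0, hP'0, hα]
    simp only [hP0, hP'0, transpose_one, mul_one, one_mul,
      fromBlocks_transpose, fromBlocks_multiply, fromBlocks_add, fromBlocks_neg, 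
      sub_eq_add_neg, transpose_neg, transpose_rowV, transpose_colV, transpose_zero,
      Matrix.mul_zero, Matrix.zero_mul, Matrix.mul_one, Matrix.one_mul, transpose_mul, hΓT, add_zero, zero_add, hQ, Matrix.mul_neg, Matrix.neg_mul, neg_zero, Matrix.add_mul,
      fromBlocks_inj, two_smul] at orth2 ⊢
    obtain ⟨h₁₁, h₁₂, h₂₁, h₂₂⟩ := orth2
    refine congrFun (congrFun (fromBlocks_inj.2 ⟨?_, ?_, ?_, ?_⟩) i) j
    · linear_combination (norm := abel) -h₁₁
    · linear_combination (norm := abel) -h₁₂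
    · linear_combination (norm := abel) -h₂₁
    · linear_combination (norm := abel) -h₂₂
end

section
/- Let d ≥ 1, T > 0 and k ∈ ℝ. Let H: ℝ^{d+1} × ℝ^{d+1} → ℝ be C^∞ and let θ = (Q, P): [0,T] → ℝ^{d+1} × ℝ^{d+1} be a solution of Hamilton's equations Q̇ = ∂_p H(Q,P), Ṗ = −∂_q H(Q,P) such that H(Q(t),P(t)) = k for all t, Q̇(0) ≠ 0, and the Hessian ∂²_{pp} H(Q(0),P(0)) is positive semidefinite. Then there exist δ ∈ (0,T], open neighborhoods V of Q(0) and Ṽ of 0 in ℝ^{d+1}, a C^∞ diffeomorphism φ: V → Ṽ with φ(Q(0)) = 0, and a C^∞ function g: Ṽ → ℝ, such that the function H̃(q,p) := H(φ⁻¹(q), (Dφ(φ⁻¹(q)))ᵀ (p + ∇g(q))), defined for q ∈ Ṽ and p ∈ ℝ^{d+1}, satisfies: (a) φ(Q(t)) = t·e₁ and (Dφ(Q(t)))ᵀ ∇g(t·e₁) = P(t) for all t ∈ [0,δ]; (b) H̃(q,0) = k for all q ∈ Ṽ; (c) ∂_p H̃(q,0) = e₁ for all q ∈ Ṽ; (d)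 the Hessian ∂²_{p̂p̂} H̃(0,0) of H̃ at (0,0) with respect to the last d momentum coordinates p̂ = (p₂,…,p_{d+1}) equals fromBlocks(I_r, 0, 0, 0) for some 0 ≤ r ≤ d. -/
open Matrix

/-- The gradient of `f : ℝⁿ → ℝ` at `x`. -/
noncomputable def grad {n : ℕ} (f : (Fin n → ℝ) → ℝ) (x : Fin n → ℝ) : Fin n → ℝ :=
  fun i => fderiv ℝ f x (Pi.single i 1)

/-- The inverse function theorem for `C^∞` maps: the local inverse is `C^∞` on its whole domain. -/
lemma exists_openPartialHomeomorph_contDiffOn_symm {X Y : Type*}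
    [NormedAddCommGroup X] [NormedSpace ℝ X] [CompleteSpace X]
    [NormedAddCommGroup Y] [NormedSpace ℝ Y] {F : X → Y} {F' : X ≃L[ℝ] Y} {U : Set X} {a : X}
    (hU : IsOpen U) (ha : a ∈ U) (hF : ContDiffOn ℝ (⊤ : ℕ∞) F U)
    (hF' : HasFDerivAt F (F' : X →L[ℝ] Y) a) :
    ∃ e : OpenPartialHomeomorph X Y, a ∈ e.source ∧ e.source ⊆ U ∧ (∀ x, e x = F x) ∧
      ContDiffOn ℝ (⊤ : ℕ∞) e.symm e.target := by
  have hFa : ContDiffAt ℝ (⊤ : ℕ∞) F a := hF.contDiffAt (hU.mem_nhds ha)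
  let e₀ := hFa.toOpenPartialHomeomorph F hF' (by simp)
  have hcont : ContinuousOn (fderiv ℝ F) U := hF.continuousOn_fderiv_of_isOpen hU (by simp)
  have hW : IsOpen (U ∩ fderiv ℝ F ⁻¹' Set.range ((↑) : (X ≃L[ℝ] Y) → X →L[ℝ] Y)) :=
    hcont.isOpen_inter_preimage hU ContinuousLinearEquiv.isOpen
  refine ⟨e₀.restrOpen _ hW, ?_, ?_, fun x => rfl, ?_⟩
  · exact ⟨hFa.mem_toOpenPartialHomeomorph_source hF' (by simp), ha, F', hF'.fderiv.symm⟩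
  · exact fun x hx => hx.2.1
  · intro y hy
    have hx := (e₀.restrOpen _ hW).map_target hy
    obtain ⟨L, hL⟩ := hx.2.2
    refine (OpenPartialHomeomorph.contDiffAt_symm (f₀' := L) _ hy ?_ ?_).contDiffWithinAt
    · rw [hL]
      exact ((hF.contDiffAt (hU.mem_nhds hx.2.1)).differentiableAt (by simp)).hasFDerivAt
    · exact hF.contDiffAt (hU.mem_nhds hx.2.1)

/-- Pointwise evaluation of a continuous family of operators on a continuous family of vectors. -/
noncomputable def pointwiseApply (K : Type*) [TopologicalSpace K] [CompactSpace K] (E F : Type*)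
    [NormedAddCommGroup E] [NormedSpace ℝ E] [NormedAddCommGroup F] [NormedSpace ℝ F] :
    C(K, E →L[ℝ] F) →L[ℝ] C(K, E) →L[ℝ] C(K, F) :=
  LinearMap.mkContinuous₂
    (LinearMap.mk₂ ℝ (fun (A : C(K, E →L[ℝ] F)) (h : C(K, E)) =>
        (⟨fun s => A s (h s), by fun_prop⟩ : C(K, F)))
      (fun A B h => by ext s; simp) (fun c A h => by ext s; simp)
      (fun A h k => by ext s; simp) (fun c A h => by ext s; simp)) 1
    (fun A h => by
      rw [ContinuousMap.norm_le _ (by positivity)]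
      intro s
      rw [one_mul]
      exact ((A s).le_opNorm _).trans
        (mul_le_mul (A.norm_coe_le_norm s) (h.norm_coe_le_norm s) (norm_nonneg _) (norm_nonneg A)))

lemma hasFDerivAt_continuousMap_comp {K : Type*} [TopologicalSpace K] [CompactSpace K] {E F : Type*}
    [NormedAddCommGroup E] [NormedSpace ℝ E] [NormedAddCommGroup F] [NormedSpace ℝ F]
    (f : C(E, F)) (f' : C(E, E →L[ℝ] F)) (hf : ∀ x, HasFDerivAt f (f' x) x) (γ : C(K, E)) :
    HasFDerivAt (fun γ : C(K, E) => f.comp γ) (pointwiseApply K E F (f'.comp γ)) γ := by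
  rw [hasFDerivAt_iff_isLittleO, Asymptotics.isLittleO_iff]
  intro c hc
  have hcont : Continuous fun γ : C(K, E) => f'.comp γ := ContinuousMap.continuous_postcomp f'
  have hev : ∀ᶠ η in nhds γ, dist (f'.comp η) (f'.comp γ) < c :=
    (hcont.tendsto γ).eventually
      (show ∀ᶠ ζ in nhds (f'.comp γ), dist ζ (f'.comp γ) < c from
        Metric.ball_mem_nhds (f'.comp γ) hc)
  obtain ⟨δ, hδ, hb⟩ := Metric.eventually_nhds_iff.1 hev
  filter_upwards [Metric.ball_mem_nhds γ hδ] with η hη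
  rw [ContinuousMap.norm_le _ (by positivity)]
  intro s
  have key : ‖f (η s) - f (γ s) - f' (γ s) (η s - γ s)‖ ≤ c * ‖η s - γ s‖ := by
    refine (convex_segment (γ s) (η s)).norm_image_sub_le_of_norm_hasFDerivWithin_le'
      (fun x _ => (hf x).hasFDerivWithinAt) ?_ (left_mem_segment ℝ _ _) (right_mem_segment ℝ _ _)
    rw [segment_eq_image']
    rintro _ ⟨τ, hτ, rfl⟩
    have h1 : dist (γ + τ • (η - γ)) γ < δ := by
      rw [dist_eq_norm, add_sub_cancel_left, norm_smul, Real.norm_of_nonneg hτ.1]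
      rw [Metric.mem_ball, dist_eq_norm] at hη
      exact (mul_le_of_le_one_left (norm_nonneg _) hτ.2).trans_lt hη
    have h2 := (ContinuousMap.dist_lt_iff hc).1 (hb h1) s
    rw [dist_eq_norm] at h2
    exact h2.le
  exact key.trans (by gcongr; exact (η - γ).norm_coe_le_norm s)

lemma contDiff_nat_continuousMap_comp.{u, v} {K : Type v} [TopologicalSpace K] [CompactSpace K]
    (n : ℕ) :
    ∀ {E F : Type u} [NormedAddCommGroup E] [NormedSpace ℝ E] [NormedAddCommGroup F]
      [NormedSpace ℝ F] (f : C(E, F)), ContDiff ℝ (⊤ : ℕ∞) f →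
      ContDiff ℝ n (fun γ : C(K, E) => f.comp γ) := by
  induction n with
  | zero =>
    intro E F _ _ _ _ f _
    exact contDiff_zero.2 (ContinuousMap.continuous_postcomp f)
  | succ n ih =>
    intro E F _ _ _ _ f hf
    have hf' : ContDiff ℝ (⊤ : ℕ∞) (fderiv ℝ f) := hf.fderiv_right (by simp)
    rw [Nat.cast_add, Nat.cast_one, contDiff_succ_iff_hasFDerivAt]
    refine ⟨_, ?_, hasFDerivAt_continuousMap_comp f ⟨fderiv ℝ f, hf'.continuous⟩
      fun x => (hf.differentiable (by simp) x).hasFDerivAt⟩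
    exact (pointwiseApply K E F).contDiff.comp (ih ⟨fderiv ℝ f, hf'.continuous⟩ hf')

/-- The Nemytskii operator of a `C^∞` map is `C^∞`. -/
lemma contDiff_continuousMap_comp.{u, v} {K : Type v} [TopologicalSpace K] [CompactSpace K]
    {E F : Type u} [NormedAddCommGroup E] [NormedSpace ℝ E]
    [NormedAddCommGroup F] [NormedSpace ℝ F] (f : C(E, F)) (hf : ContDiff ℝ (⊤ : ℕ∞) f) :
    ContDiff ℝ (⊤ : ℕ∞) (fun γ : C(K, E) => f.comp γ) :=
  contDiff_infty.2 fun n => contDiff_nat_continuousMap_comp n f hf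

/-- The primitive vanishing at `0` of a continuous function on `[-1, 1]`. -/
noncomputable def primitive (E : Type*) [NormedAddCommGroup E] [NormedSpace ℝ E] [CompleteSpace E] :
    C(Set.Icc (-1 : ℝ) 1, E) →L[ℝ] C(Set.Icc (-1 : ℝ) 1, E) :=
  LinearMap.mkContinuous
    { toFun := fun γ => ⟨fun s => ∫ u in (0 : ℝ)..s, Set.IccExtend (by norm_num) γ u,
        (intervalIntegral.continuous_primitive
          (fun a b => (γ.continuous.Icc_extend' (h := by norm_num)).intervalIntegrable a b) 0).comp
          continuous_subtype_val⟩
      map_add' := fun γ η => by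
        ext s
        exact intervalIntegral.integral_add
          ((γ.continuous.Icc_extend' (h := by norm_num)).intervalIntegrable _ _)
          ((η.continuous.Icc_extend' (h := by norm_num)).intervalIntegrable _ _)
      map_smul' := fun c γ => by
        ext s
        exact intervalIntegral.integral_smul c _ } 1
    (fun γ => by
      rw [ContinuousMap.norm_le _ (by positivity)]
      intro s
      refine (intervalIntegral.norm_integral_le_of_norm_le_const (C := ‖γ‖)
        fun u _ => γ.norm_coe_le_norm _).trans ?_
      rw [one_mul, sub_zero]
      exact mul_le_of_le_one_right (norm_nonneg γ) (abs_le.2 s.2))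

lemma primitive_apply {E : Type*} [NormedAddCommGroup E] [NormedSpace ℝ E] [CompleteSpace E]
    (γ : C(Set.Icc (-1 : ℝ) 1, E)) (s : Set.Icc (-1 : ℝ) 1) :
    primitive E γ s = ∫ u in (0 : ℝ)..s, Set.IccExtend (by norm_num) γ u := rfl

/-- Multiplication by `s ∈ [-1, 1]` on `[-1, 1]`. -/
def scaleIcc (s : Set.Icc (-1 : ℝ) 1) : C(Set.Icc (-1 : ℝ) 1, Set.Icc (-1 : ℝ) 1) :=
  ⟨fun u => ⟨s * u, abs_le.1 (by
    rw [abs_mul]; exact mul_le_one₀ (abs_le.2 s.2) (abs_nonneg _) (abs_le.2 u.2))⟩, by fun_prop⟩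

lemma primitive_comp_scaleIcc {E : Type*} [NormedAddCommGroup E] [NormedSpace ℝ E]
    [CompleteSpace E] (γ : C(Set.Icc (-1 : ℝ) 1, E)) (s : Set.Icc (-1 : ℝ) 1) :
    (s : ℝ) • primitive E (γ.comp (scaleIcc s)) = (primitive E γ).comp (scaleIcc s) := by
  ext u
  change (s : ℝ) • primitive E (γ.comp (scaleIcc s)) u = primitive E γ (scaleIcc s u)
  rw [primitive_apply, primitive_apply]
  change _ = ∫ v in (0 : ℝ)..(s : ℝ) * u, Set.IccExtend _ γ v
  have h := intervalIntegral.smul_integral_comp_mul_left (a := 0) (b := (u : ℝ))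
    (Set.IccExtend (by norm_num : (-1 : ℝ) ≤ 1) γ) (s : ℝ)
  rw [mul_zero] at h
  rw [← h]
  congr 1
  refine intervalIntegral.integral_congr fun v hv => ?_
  have h0 : (0 : ℝ) ∈ Set.Icc (-1 : ℝ) 1 := by norm_num
  have hv' : v ∈ Set.Icc (-1 : ℝ) 1 := Set.uIcc_subset_Icc h0 u.2 hv
  rw [Set.IccExtend_of_mem _ _ hv']
  exact (Set.IccExtend_of_mem _ _ (scaleIcc s ⟨v, hv'⟩).2).symm

/-- Smooth dependence of the local flow of a `C^∞` vector field on time and initial condition. -/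
lemma exists_contDiffOn_flow {E : Type*} [NormedAddCommGroup E] [NormedSpace ℝ E]
    [CompleteSpace E] {f : E → E} (hf : ContDiff ℝ (⊤ : ℕ∞) f) (x₀ : E) :
    ∃ (ε : ℝ) (U : Set E) (Φ : ℝ → E → E), 0 < ε ∧ IsOpen U ∧ x₀ ∈ U ∧
      ContDiffOn ℝ (⊤ : ℕ∞) (fun z : ℝ × E => Φ z.1 z.2) (Set.Ioo (-ε) ε ×ˢ U) ∧
      ∀ x ∈ U, Φ 0 x = x ∧ ∀ t ∈ Set.Ioo (-ε) ε, HasDerivAt (fun s => Φ s x) (f (Φ t x)) t := by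
  let K := Set.Icc (-1 : ℝ) 1
  let fc : C(E, E) := ⟨f, hf.continuous⟩
  let N : C(K, E) → C(K, E) := fun γ => primitive E (fc.comp γ)
  have hN : ContDiff ℝ (⊤ : ℕ∞) N :=
    (primitive E).contDiff.comp (contDiff_continuousMap_comp fc hf)
  let cst : E →L[ℝ] C(K, E) := ContinuousLinearMap.const ℝ K
  let F : (E × ℝ) × C(K, E) → (E × ℝ) × C(K, E) :=
    fun z => (z.1, z.2 - cst z.1.1 - z.1.2 • N z.2)
  have hF : ContDiff ℝ (⊤ : ℕ∞) F := by
    have h1 : ContDiff ℝ (⊤ : ℕ∞) fun z : (E × ℝ) × C(K, E) => N z.2 := hN.comp contDiff_snd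
    have h2 : ContDiff ℝ (⊤ : ℕ∞) fun z : (E × ℝ) × C(K, E) => cst z.1.1 :=
      cst.contDiff.comp (contDiff_fst.comp contDiff_fst)
    have h3 : ContDiff ℝ (⊤ : ℕ∞) fun z : (E × ℝ) × C(K, E) => z.1.2 :=
      contDiff_snd.comp contDiff_fst
    exact contDiff_fst.prodMk ((contDiff_snd.sub h2).sub (h3.smul h1))
  let γ₀ := cst x₀
  let A : E × ℝ →L[ℝ] C(K, E) := cst.comp (ContinuousLinearMap.fst ℝ E ℝ) +
    (ContinuousLinearMap.snd ℝ E ℝ).smulRight (N γ₀)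
  let F' := (ContinuousLinearEquiv.refl ℝ (E × ℝ)).skewProd (ContinuousLinearEquiv.refl ℝ C(K, E))
    (-A)
  have hF' : HasFDerivAt F (F' : (E × ℝ) × C(K, E) →L[ℝ] (E × ℝ) × C(K, E)) ((x₀, 0), γ₀) := by
    have h1 : HasFDerivAt (fun z : (E × ℝ) × C(K, E) => z.1.2)
        ((ContinuousLinearMap.snd ℝ E ℝ).comp (ContinuousLinearMap.fst ℝ (E × ℝ) C(K, E)))
        ((x₀, 0), γ₀) := ((ContinuousLinearMap.snd ℝ E ℝ).comp
          (ContinuousLinearMap.fst ℝ (E × ℝ) C(K, E))).hasFDerivAt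
    have h2 : HasFDerivAt (fun z : (E × ℝ) × C(K, E) => N z.2)
        ((fderiv ℝ N γ₀).comp (ContinuousLinearMap.snd ℝ (E × ℝ) C(K, E))) ((x₀, 0), γ₀) :=
      HasFDerivAt.comp (g := N) ((x₀, (0 : ℝ)), γ₀) (hN.differentiable (by simp) γ₀).hasFDerivAt
        hasFDerivAt_snd
    have h3 : HasFDerivAt (fun z : (E × ℝ) × C(K, E) => cst z.1.1)
        (cst.comp ((ContinuousLinearMap.fst ℝ E ℝ).comp
          (ContinuousLinearMap.fst ℝ (E × ℝ) C(K, E)))) ((x₀, 0), γ₀) :=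
      (cst.comp ((ContinuousLinearMap.fst ℝ E ℝ).comp
          (ContinuousLinearMap.fst ℝ (E × ℝ) C(K, E)))).hasFDerivAt
    have h4 := hasFDerivAt_fst.prodMk ((hasFDerivAt_snd.sub h3).sub (h1.smul h2))
    refine h4.congr_fderiv ?_
    refine ContinuousLinearMap.ext fun z => ?_
    refine Prod.ext rfl ?_
    simp [F', A]
    abel
  obtain ⟨e, ha, -, he, hsymm⟩ := exists_openPartialHomeomorph_contDiffOn_symm isOpen_univ
    (Set.mem_univ _) hF.contDiffOn hF'
  have hFa : e ((x₀, 0), γ₀) = ((x₀, 0), 0) := by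
    rw [he]; simp [F, γ₀]
  obtain ⟨r, hr, hball⟩ := Metric.isOpen_iff.1 e.open_source _ ha
  have hW : ∀ᶠ z : E × ℝ in nhds (x₀, 0), (z, (0 : C(K, E))) ∈ e.target ∧
      dist (e.symm (z, 0)) ((x₀, 0), γ₀) < r := by
    have hc : Continuous fun z : E × ℝ => (z, (0 : C(K, E))) := by fun_prop
    have hat : ((x₀, (0 : ℝ)), (0 : C(K, E))) ∈ e.target := hFa ▸ e.map_source ha
    have hsa : e.symm ((x₀, 0), 0) = ((x₀, 0), γ₀) := by rw [← hFa, e.left_inv ha]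
    have h1 : ∀ᶠ w in nhds ((x₀, (0 : ℝ)), (0 : C(K, E))), w ∈ e.target :=
      e.open_target.mem_nhds hat
    have h2 : ∀ᶠ w in nhds ((x₀, (0 : ℝ)), (0 : C(K, E))), e.symm w ∈
        Metric.ball ((x₀, (0 : ℝ)), γ₀) r := by
      have h3 := e.continuousAt_symm hat
      refine h3.eventually ?_
      rw [hsa]
      exact Metric.ball_mem_nhds _ hr
    exact (hc.tendsto (x₀, 0)).eventually (h1.and h2)
  obtain ⟨ρ, hρ, hWρ⟩ := Metric.eventually_nhds_iff.1 hW
  let γ : E × ℝ → C(K, E) := fun z => (e.symm (z, 0)).2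
  have hsol : ∀ z : E × ℝ, (z, (0 : C(K, E))) ∈ e.target →
      e.symm (z, 0) = (z, γ z) ∧ γ z - cst z.1 - z.2 • N (γ z) = 0 := by
    intro z hz
    have h1 : F (e.symm (z, 0)) = (z, 0) := by rw [← he, e.right_inv hz]
    have h2 : (e.symm (z, 0)).1 = z := congrArg Prod.fst h1
    have h3 : e.symm (z, 0) = (z, γ z) := Prod.ext h2 rfl
    rw [h3] at h1
    exact ⟨h3, congrArg Prod.snd h1⟩
  have hε₀ : 0 < ρ / 2 := half_pos hρ
  set ε₀ := ρ / 2 with hε₀_def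
  have hmem : ∀ x ∈ Metric.ball x₀ ρ, ∀ t : ℝ, |t| ≤ ε₀ → dist (x, t) (x₀, 0) < ρ := by
    intro x hx t ht
    rw [Prod.dist_eq, Real.dist_eq, sub_zero]
    exact max_lt hx (by linarith)
  have hscale : ∀ x ∈ Metric.ball x₀ ρ, ∀ s : K,
      γ (x, s * ε₀) = (γ (x, ε₀)).comp (scaleIcc s) := by
    intro x hx s
    obtain ⟨ht, hd⟩ := hWρ (hmem x hx ε₀ (abs_of_pos hε₀).le)
    obtain ⟨h1, h2⟩ := hsol _ ht
    rw [h1, Prod.dist_eq, max_lt_iff, Prod.dist_eq, max_lt_iff] at hd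
    obtain ⟨⟨hd1, hd2⟩, hd3⟩ := hd
    have hs : |(s : ℝ)| ≤ 1 := abs_le.2 s.2
    have hb : ((x, s * ε₀), (γ (x, ε₀)).comp (scaleIcc s)) ∈ e.source := by
      apply hball
      rw [Metric.mem_ball, Prod.dist_eq, max_lt_iff, Prod.dist_eq, max_lt_iff]
      refine ⟨⟨hd1, ?_⟩, ?_⟩
      · rw [Real.dist_eq, sub_zero] at hd2 ⊢
        rw [abs_mul]
        exact (mul_le_of_le_one_left (abs_nonneg _) hs).trans_lt hd2
      · rw [ContinuousMap.dist_lt_iff hr] at hd3 ⊢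
        exact fun u => hd3 (scaleIcc s u)
    have hFb : F ((x, s * ε₀), (γ (x, ε₀)).comp (scaleIcc s)) = ((x, s * ε₀), 0) := by
      refine Prod.ext rfl ?_
      have h3 : ((s : ℝ) * ε₀) • N ((γ (x, ε₀)).comp (scaleIcc s)) =
          ε₀ • (N (γ (x, ε₀))).comp (scaleIcc s) := by
        rw [mul_comm, mul_smul]
        congr 1
        exact primitive_comp_scaleIcc (fc.comp (γ (x, ε₀))) s
      change _ - _ - ((s : ℝ) * ε₀) • N ((γ (x, ε₀)).comp (scaleIcc s)) = 0
      rw [h3]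
      ext u
      exact congrArg (fun η : C(K, E) => η (scaleIcc s u)) h2
    have h4 := e.left_inv hb
    rw [he, hFb] at h4
    exact congrArg Prod.snd h4
  let one : K := ⟨1, by norm_num [K]⟩
  have hval : ∀ x ∈ Metric.ball x₀ ρ, ∀ s : K, γ (x, s * ε₀) one = γ (x, ε₀) s := by
    intro x hx s
    rw [hscale x hx s]
    have h : scaleIcc s one = s := Subtype.ext (mul_one (s : ℝ))
    rw [ContinuousMap.comp_apply, h]
  have hγone : ∀ x ∈ Metric.ball x₀ ρ, ∀ s : K, γ (x, s * ε₀) one =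
      x + ε₀ • ∫ u in (0 : ℝ)..s, Set.IccExtend (by norm_num) (fc.comp (γ (x, ε₀))) u := by
    intro x hx s
    rw [hval x hx s]
    obtain ⟨ht, -⟩ := hWρ (hmem x hx ε₀ (abs_of_pos hε₀).le)
    have h2 := congrArg (fun η : C(K, E) => η s) (hsol _ ht).2
    have h3 : γ (x, ε₀) s - x - ε₀ • primitive E (fc.comp (γ (x, ε₀))) s = 0 := h2
    rw [primitive_apply, sub_sub, sub_eq_zero] at h3
    exact h3
  have hmemK : ∀ t ∈ Set.Ioo (-ε₀) ε₀, t / ε₀ ∈ Set.Ioo (-1 : ℝ) 1 := by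
    intro t ht
    rw [Set.mem_Ioo, lt_div_iff₀ hε₀, div_lt_one hε₀]
    exact ⟨by linarith [ht.1], ht.2⟩
  refine ⟨ε₀, Metric.ball x₀ ρ, fun t x => γ (x, t) one, hε₀, Metric.isOpen_ball,
    Metric.mem_ball_self hρ, ?_, fun x hx => ⟨?_, fun t ht => ?_⟩⟩
  · have h1 : ContDiffOn ℝ (⊤ : ℕ∞) (fun z : ℝ × E => e.symm ((z.2, z.1), 0))
        (Set.Ioo (-ε₀) ε₀ ×ˢ Metric.ball x₀ ρ) := by
      refine hsymm.comp (t := e.target) (f := fun z : ℝ × E => ((z.2, z.1), (0 : C(K, E))))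
        ((contDiff_snd.prodMk contDiff_fst).prodMk contDiff_const).contDiffOn ?_
      rintro ⟨t, x⟩ ⟨ht, hx⟩
      exact (hWρ (hmem x hx t (abs_le.2 ⟨ht.1.le, ht.2.le⟩))).1
    exact (ContinuousMap.evalCLM ℝ one).contDiff.comp_contDiffOn (contDiff_snd.comp_contDiffOn h1)
  · have h := hγone x hx ⟨0, by norm_num [K]⟩
    simpa using h
  · have hev : (fun s => γ (x, s) one) =ᶠ[nhds t] fun s => x + ε₀ • ∫ u in (0 : ℝ)..(s / ε₀),
        Set.IccExtend (by norm_num) (fc.comp (γ (x, ε₀))) u := by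
      filter_upwards [Ioo_mem_nhds ht.1 ht.2] with s hs
      have h := hγone x hx ⟨s / ε₀, Set.Ioo_subset_Icc_self (hmemK s hs)⟩
      rwa [Subtype.coe_mk, div_mul_cancel₀ _ hε₀.ne'] at h
    refine HasDerivAt.congr_of_eventuallyEq ?_ hev
    have hcont : Continuous (Set.IccExtend (by norm_num : (-1 : ℝ) ≤ 1) (fc.comp (γ (x, ε₀)))) :=
      (fc.comp (γ (x, ε₀))).continuous.Icc_extend'
    have h1 := hcont.integral_hasStrictDerivAt 0 (t / ε₀)
    have h2 := ((h1.hasDerivAt.scomp t ((hasDerivAt_id t).div_const ε₀)).const_smul ε₀).const_add x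
    convert! h2 using 1
    have hK := Set.Ioo_subset_Icc_self (hmemK t ht)
    have h3 := hval x hx ⟨t / ε₀, hK⟩
    rw [Subtype.coe_mk, div_mul_cancel₀ _ hε₀.ne'] at h3
    rw [smul_smul, mul_one_div_cancel hε₀.ne', one_smul, Set.IccExtend_of_mem _ _ hK]
    exact congrArg f h3

/-- The elements satisfying `p` can be moved to the front by a permutation. -/
lemma exists_perm_apply_iff_lt {d : ℕ} (p : Fin d → Prop) :
    ∃ σ : Equiv.Perm (Fin d), ∃ r ≤ d, ∀ i, p (σ i) ↔ (i : ℕ) < r := by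
  classical
  let f : Fin d → ℕ := fun i => if p i then 0 else 1
  have hmono : ∀ i j, i ≤ j → p (Tuple.sort f j) → p (Tuple.sort f i) := by
    intro i j hij hj
    by_contra hi
    have h := Tuple.monotone_sort f hij
    simp [f, hi, hj] at h
  have hex : ∃ r, ∀ i : Fin d, r ≤ (i : ℕ) → ¬ p (Tuple.sort f i) :=
    ⟨d, fun i hi => absurd i.2 hi.not_gt⟩
  refine ⟨Tuple.sort f, Nat.find hex, Nat.find_min' hex fun i hi => absurd i.2 hi.not_gt,
    fun i => ⟨fun hi => ?_, fun hi => ?_⟩⟩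
  · by_contra h
    exact Nat.find_spec hex i (not_lt.1 h) hi
  · have h := Nat.find_min hex hi
    push Not at h
    obtain ⟨j, hij, hj⟩ := h
    exact hmono i j hij hj

/-- Sylvester normal form of a real positive semidefinite matrix. -/
lemma Matrix.PosSemidef.exists_congr_diagonal {d : ℕ} {S : Matrix (Fin d) (Fin d) ℝ}
    (hS : S.PosSemidef) :
    ∃ C D : Matrix (Fin d) (Fin d) ℝ, C * D = 1 ∧ ∃ r ≤ d,
      C * S * Cᵀ = diagonal fun i : Fin d => if (i : ℕ) < r then (1 : ℝ) else 0 := by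
  let U : Matrix (Fin d) (Fin d) ℝ := hS.1.eigenvectorUnitary
  let ev := hS.1.eigenvalues
  have hU : Uᵀ * U = 1 := by
    have := Unitary.coe_star_mul_self hS.1.eigenvectorUnitary
    simpa [star_eq_conjTranspose] using this
  have hSU : S = U * diagonal ev * Uᵀ := by
    have := hS.1.spectral_theorem
    rw [Unitary.conjStarAlgAut_apply] at this
    simpa [star_eq_conjTranspose] using this
  obtain ⟨σ, r, hr, hσ⟩ := exists_perm_apply_iff_lt fun i => 0 < ev i
  let c : Fin d → ℝ := fun i => if 0 < ev (σ i) then (√(ev (σ i)))⁻¹ else 1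
  have hc : ∀ i, c i ≠ 0 := by
    intro i
    by_cases h : 0 < ev (σ i)
    · simp [c, h, (Real.sqrt_pos.2 h).ne']
    · simp [c, h]
  let Pm : Matrix (Fin d) (Fin d) ℝ := (1 : Matrix (Fin d) (Fin d) ℝ).submatrix σ id
  have hP : Pm * Pmᵀ = 1 := by
    ext i j
    simp [Pm, Matrix.mul_apply, Matrix.one_apply]
  refine ⟨diagonal c * Pm * Uᵀ, U * Pmᵀ * diagonal fun i => (c i)⁻¹, ?_, r, hr, ?_⟩
  · calc diagonal c * Pm * Uᵀ * (U * Pmᵀ * diagonal fun i => (c i)⁻¹)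
        = diagonal c * (Pm * (Uᵀ * U) * Pmᵀ) * diagonal fun i => (c i)⁻¹ := by
          simp only [Matrix.mul_assoc]
      _ = 1 := by
          rw [hU, Matrix.mul_one, hP, Matrix.mul_one, diagonal_mul_diagonal, ← diagonal_one]
          congr 1
          ext i
          exact mul_inv_cancel₀ (hc i)
  · calc diagonal c * Pm * Uᵀ * S * (diagonal c * Pm * Uᵀ)ᵀ
        = diagonal c * Pm * (Uᵀ * U) * diagonal ev * (Uᵀ * U) * (Pmᵀ * diagonal c) := by
          rw [hSU]
          simp only [Matrix.mul_assoc, Matrix.transpose_mul, diagonal_transpose, transpose_transpose]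
      _ = diagonal c * (Pm * diagonal ev * Pmᵀ) * diagonal c := by
          rw [hU]; simp only [Matrix.mul_assoc, Matrix.mul_one]
      _ = _ := by
          have h1 : Pm * diagonal ev * Pmᵀ = diagonal (ev ∘ σ) := by
            ext i j
            simp [Pm, Matrix.mul_apply, Matrix.one_apply, Matrix.diagonal_apply]
            split_ifs with h <;> simp [h]
          rw [h1, diagonal_mul_diagonal, diagonal_mul_diagonal]
          congr 1
          ext i
          by_cases h : 0 < ev (σ i)
          · have h2 := Real.mul_self_sqrt h.le
            have h3 := (Real.sqrt_pos.2 h).ne'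
            simp only [c, h, if_true, Function.comp, (hσ i).1 h]
            field_simp
            rw [sq, h2]
          · have h2 : ev (σ i) = 0 := le_antisymm (not_lt.1 h) (hS.eigenvalues_nonneg _)
            rw [if_neg (fun h' => h ((hσ i).2 h'))]
            simp [h2]

/-- A linear frame sending `v` to the first basis vector and normalizing a positive semidefinite
form in the remaining directions. -/
lemma exists_adapted_frame {d : ℕ} {A : Matrix (Fin (d + 1)) (Fin (d + 1)) ℝ} (hA : A.PosSemidef)
    {v : Fin (d + 1) → ℝ} (hv : v ≠ 0) :
    ∃ L M : Matrix (Fin (d + 1)) (Fin (d + 1)) ℝ, L * M = 1 ∧ M * L = 1 ∧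
      L *ᵥ v = Pi.single 0 1 ∧ ∃ r ≤ d, ∀ a b : Fin d,
        (L * A * Lᵀ) a.succ b.succ = if a = b ∧ (a : ℕ) < r then 1 else 0 := by
  have he : (Pi.single 0 1 : Fin (d + 1) → ℝ) ≠ 0 := by simp
  obtain ⟨T, hT⟩ := SeparatingDual.exists_continuousLinearEquiv_apply_eq (R := ℝ) hv he
  let L₀ : Matrix (Fin (d + 1)) (Fin (d + 1)) ℝ :=
    LinearMap.toMatrix' (T.toLinearEquiv : (Fin (d + 1) → ℝ) →ₗ[ℝ] (Fin (d + 1) → ℝ))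
  let M₀ : Matrix (Fin (d + 1)) (Fin (d + 1)) ℝ :=
    LinearMap.toMatrix' (T.symm.toLinearEquiv : (Fin (d + 1) → ℝ) →ₗ[ℝ] (Fin (d + 1) → ℝ))
  have hLM : L₀ * M₀ = 1 := by
    rw [← LinearMap.toMatrix'_comp, ← LinearMap.toMatrix'_id]
    congr 1
    ext i
    simp
  have hLv : L₀ *ᵥ v = Pi.single 0 1 := by
    rw [LinearMap.toMatrix'_mulVec]
    exact hT
  have hS : ((L₀ * A * L₀ᵀ).submatrix Fin.succ Fin.succ).PosSemidef := by
    have := (hA.mul_mul_conjTranspose_same L₀).submatrix (Fin.succ : Fin d → Fin (d + 1))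
    rwa [conjTranspose_eq_transpose_of_trivial] at this
  obtain ⟨C, D, hCD, r, hr, hdiag⟩ := hS.exists_congr_diagonal
  let B : Matrix (Fin d) (Fin d) ℝ → Matrix (Fin (d + 1)) (Fin (d + 1)) ℝ := fun X =>
    Matrix.of fun i j => Fin.cases (Fin.cases 1 (fun _ => 0) j) (fun a => Fin.cases 0 (X a) j) i
  have hB : B C * B D = 1 := by
    ext i j
    have h : ∀ a b, ∑ x, C a x * D x b = (1 : Matrix (Fin d) (Fin d) ℝ) a b := by
      intro a b
      rw [← hCD, Matrix.mul_apply]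
    refine Fin.cases ?_ (fun a => ?_) i <;> refine Fin.cases ?_ (fun b => ?_) j <;>
      simp [B, Matrix.mul_apply, Fin.sum_univ_succ, h, Matrix.one_apply, (Fin.succ_ne_zero _).symm]
  have hLM' : B C * L₀ * (M₀ * B D) = 1 := by
    rw [Matrix.mul_assoc, ← Matrix.mul_assoc L₀, hLM, Matrix.one_mul, hB]
  refine ⟨B C * L₀, M₀ * B D, hLM', mul_eq_one_comm.1 hLM', ?_, r, hr, fun a b => ?_⟩
  · rw [← Matrix.mulVec_mulVec, hLv]
    ext i
    refine Fin.cases ?_ (fun a => ?_) i <;> simp [B, Matrix.mulVec, dotProduct, Fin.sum_univ_succ]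
  · have h1 : B C * L₀ * A * (B C * L₀)ᵀ = B C * (L₀ * A * L₀ᵀ) * (B C)ᵀ := by
      rw [transpose_mul]; simp only [Matrix.mul_assoc]
    have h2 := congrFun (congrFun hdiag a) b
    rw [h1]
    rw [Matrix.diagonal_apply] at h2
    rw [ite_and, ← h2]
    simp [B, Matrix.mul_apply, Fin.sum_univ_succ]

/-- Implicit function theorem, `C^∞` version with a scalar unknown. -/
lemma exists_contDiffOn_implicit {X : Type*} [NormedAddCommGroup X] [NormedSpace ℝ X]
    [CompleteSpace X] {G : X × ℝ → ℝ} (hG : ContDiff ℝ (⊤ : ℕ∞) G)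
    (h1 : fderiv ℝ G 0 (0, 1) = 1) :
    ∃ (U : Set X) (σ : X → ℝ), IsOpen U ∧ 0 ∈ U ∧ ContDiffOn ℝ (⊤ : ℕ∞) σ U ∧ σ 0 = 0 ∧
      ∀ x ∈ U, G (x, σ x) = G 0 := by
  let A : X →L[ℝ] ℝ := (fderiv ℝ G 0).comp (ContinuousLinearMap.inl ℝ X ℝ)
  let F' := (ContinuousLinearEquiv.refl ℝ X).skewProd (ContinuousLinearEquiv.refl ℝ ℝ) A
  have hF : ContDiff ℝ (⊤ : ℕ∞) fun z : X × ℝ => (z.1, G z) := contDiff_fst.prodMk hG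
  have hF' : HasFDerivAt (fun z : X × ℝ => (z.1, G z)) (F' : X × ℝ →L[ℝ] X × ℝ) 0 := by
    have h2 := hasFDerivAt_fst.prodMk (hG.differentiable (by simp) (0 : X × ℝ)).hasFDerivAt
    refine h2.congr_fderiv (ContinuousLinearMap.ext fun z => Prod.ext rfl ?_)
    have h3 : z = (z.1, 0) + z.2 • ((0, 1) : X × ℝ) := by ext <;> simp
    change fderiv ℝ G 0 z = z.2 + fderiv ℝ G 0 (z.1, 0)
    conv_lhs => rw [h3, map_add, map_smul, h1]
    simp [add_comm]
  obtain ⟨e, ha, -, he, hsymm⟩ := exists_openPartialHomeomorph_contDiffOn_symm isOpen_univ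
    (Set.mem_univ _) hF.contDiffOn hF'
  have hc : Continuous fun x : X => (x, G 0) := by fun_prop
  have h0 : e 0 = (0, G 0) := he 0
  refine ⟨(fun x : X => (x, G 0)) ⁻¹' e.target, fun x => (e.symm (x, G 0)).2,
    e.open_target.preimage hc, ?_, ?_, ?_, fun x hx => ?_⟩
  · change ((0 : X), G 0) ∈ e.target
    rw [← h0]
    exact e.map_source ha
  · exact contDiff_snd.comp_contDiffOn
      (hsymm.comp (contDiff_id.prodMk contDiff_const).contDiffOn fun x hx => hx)
  · change (e.symm (0, G 0)).2 = 0
    rw [← h0, e.left_inv ha]; rfl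
  · have h2 : e (e.symm (x, G 0)) = (x, G 0) := e.right_inv hx
    rw [he] at h2
    have h3 : (e.symm (x, G 0)).1 = x := congrArg Prod.fst h2
    have h4 : G (e.symm (x, G 0)) = G 0 := congrArg Prod.snd h2
    have h5 : (x, (e.symm (x, G 0)).2) = e.symm (x, G 0) := Prod.ext h3.symm rfl
    rw [h5, h4]

/-- The projection of `ℝ^{d+1}` onto the hyperplane where the first coordinate vanishes. -/
noncomputable def dropFirst (d : ℕ) : (Fin (d + 1) → ℝ) →L[ℝ] (Fin (d + 1) → ℝ) :=
  ContinuousLinearMap.id ℝ _ -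
    (ContinuousLinearMap.proj (R := ℝ) (φ := fun _ : Fin (d + 1) => ℝ) 0).smulRight
      (Pi.single 0 1 : Fin (d + 1) → ℝ)

lemma dropFirst_apply {d : ℕ} (q : Fin (d + 1) → ℝ) :
    dropFirst d q = q - q 0 • (Pi.single 0 1 : Fin (d + 1) → ℝ) := rfl

@[simp] lemma dropFirst_apply_zero {d : ℕ} (q : Fin (d + 1) → ℝ) : dropFirst d q 0 = 0 := by
  simp [dropFirst_apply]

lemma dropFirst_eq_self {d : ℕ} {q : Fin (d + 1) → ℝ} (hq : q 0 = 0) : dropFirst d q = q := by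
  simp [dropFirst_apply, hq]

lemma dropFirst_add_smul {d : ℕ} (q : Fin (d + 1) → ℝ) :
    dropFirst d q + q 0 • (Pi.single 0 1 : Fin (d + 1) → ℝ) = q := by
  simp [dropFirst_apply]

lemma dropFirst_add_smul_single {d : ℕ} (q : Fin (d + 1) → ℝ) (t : ℝ) :
    dropFirst d (q + t • (Pi.single 0 1 : Fin (d + 1) → ℝ)) = dropFirst d q := by
  ext i
  simp [dropFirst_apply]
  ring

lemma dropFirst_add_smul_mem_ball {d : ℕ} {q : Fin (d + 1) → ℝ} {ρ : ℝ}
    (hq : q ∈ Metric.ball 0 ρ) {t : ℝ} (ht : |t| ≤ |q 0|) :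
    dropFirst d q + t • (Pi.single 0 1 : Fin (d + 1) → ℝ) ∈ Metric.ball 0 ρ := by
  have hρ : 0 < ρ := Metric.pos_of_mem_ball hq
  rw [mem_ball_zero_iff, pi_norm_lt_iff hρ] at hq ⊢
  intro i
  refine Fin.cases ?_ (fun a => ?_) i
  · simpa using ht.trans_lt (hq 0)
  · simpa [dropFirst_apply] using hq a.succ

lemma dropFirst_mem_ball {d : ℕ} {q : Fin (d + 1) → ℝ} {ρ : ℝ}
    (hq : q ∈ Metric.ball 0 ρ) : dropFirst d q ∈ Metric.ball 0 ρ := by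
  simpa using dropFirst_add_smul_mem_ball hq (t := 0) (by simp)

lemma hasDerivAt_comp_add_smul {d : ℕ} {W : Type*} [NormedAddCommGroup W] [NormedSpace ℝ W]
    {u : (Fin (d + 1) → ℝ) → W} {q e : Fin (d + 1) → ℝ} {t : ℝ}
    (hu : DifferentiableAt ℝ u (q + t • e)) :
    HasDerivAt (fun s : ℝ => u (q + s • e)) (fderiv ℝ u (q + t • e) e) t := by
  have h1 : HasDerivAt (fun s : ℝ => q + s • e) e t := by
    simpa using ((hasDerivAt_id t).smul_const e).const_add q
  exact hu.hasFDerivAt.comp_hasDerivAt t h1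

lemma eq_comp_dropFirst_of_fderiv_eq_zero {d : ℕ} {W : Type*} [NormedAddCommGroup W]
    [NormedSpace ℝ W] {u : (Fin (d + 1) → ℝ) → W} {ρ : ℝ}
    (hu : DifferentiableOn ℝ u (Metric.ball 0 ρ))
    (h0 : ∀ q ∈ Metric.ball 0 ρ, fderiv ℝ u q (Pi.single 0 1) = 0)
    {q : Fin (d + 1) → ℝ} (hq : q ∈ Metric.ball 0 ρ) : u q = u (dropFirst d q) := by
  have hd : ∀ t ∈ Set.uIcc 0 (q 0), HasDerivWithinAt
      (fun s : ℝ => u (dropFirst d q + s • (Pi.single 0 1 : Fin (d + 1) → ℝ))) 0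
      (Set.uIcc 0 (q 0)) t := by
    intro t ht
    have ht' : |t| ≤ |q 0| := by simpa using Set.abs_sub_left_of_mem_uIcc ht
    have hm := dropFirst_add_smul_mem_ball hq ht'
    have := hasDerivAt_comp_add_smul (hu.differentiableAt (Metric.isOpen_ball.mem_nhds hm))
    rw [h0 _ hm] at this
    exact this.hasDerivWithinAt
  have h := (convex_uIcc 0 (q 0)).norm_image_sub_le_of_norm_hasDerivWithin_le (C := 0) hd
    (by simp) Set.left_mem_uIcc Set.right_mem_uIcc
  rw [zero_mul, norm_le_zero_iff, dropFirst_add_smul, zero_smul, add_zero, sub_eq_zero] at h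
  exact h

/-- Flowing out of the hyperplane `q 0 = 0` along a smooth vector field, starting from `ξ`. -/
lemma exists_contDiffOn_flowout {d : ℕ} {Z : Type*} [NormedAddCommGroup Z] [NormedSpace ℝ Z]
    [CompleteSpace Z] {f : Z → Z} (hf : ContDiff ℝ (⊤ : ℕ∞) f)
    {U : Set (Fin (d + 1) → ℝ)} (hU : IsOpen U) (h0 : 0 ∈ U) {ξ : (Fin (d + 1) → ℝ) → Z}
    (hξ : ContDiffOn ℝ (⊤ : ℕ∞) ξ U) :
    ∃ ρ > 0, Metric.ball 0 ρ ⊆ U ∧ ∃ F : (Fin (d + 1) → ℝ) → Z,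
      ContDiffOn ℝ (⊤ : ℕ∞) F (Metric.ball 0 ρ) ∧
      (∀ q ∈ Metric.ball 0 ρ, fderiv ℝ F q (Pi.single 0 1) = f (F q)) ∧
      ∀ q ∈ Metric.ball 0 ρ, F (dropFirst d q) = ξ (dropFirst d q) := by
  obtain ⟨ε, S, Φ, hε, hS, hxS, hΦ, hflow⟩ := exists_contDiffOn_flow hf (ξ 0)
  have hev : ∀ᶠ q : Fin (d + 1) → ℝ in nhds 0, q ∈ U ∧ ξ q ∈ S ∧ q 0 ∈ Set.Ioo (-ε) ε := by
    have hU' : ∀ᶠ q in nhds (0 : Fin (d + 1) → ℝ), q ∈ U := hU.mem_nhds h0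
    refine hU'.and (Filter.Eventually.and ?_ ?_)
    · exact (hξ.contDiffAt (hU.mem_nhds h0)).continuousAt.eventually (hS.mem_nhds hxS)
    · exact (continuous_apply (0 : Fin (d + 1))).continuousAt.eventually
        (Ioo_mem_nhds (by simpa using hε) (by simpa using hε))
  obtain ⟨ρ, hρ, hball⟩ := Metric.eventually_nhds_iff_ball.1 hev
  have hF : ContDiffOn ℝ (⊤ : ℕ∞) (fun q => Φ (q 0) (ξ (dropFirst d q))) (Metric.ball 0 ρ) := by
    refine hΦ.comp (f := fun q : Fin (d + 1) → ℝ => (q 0, ξ (dropFirst d q)))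
      (ContDiffOn.prodMk (contDiff_apply ℝ ℝ 0).contDiffOn
        (hξ.comp (dropFirst d).contDiff.contDiffOn ?_)) ?_
    · exact fun q hq => (hball _ (dropFirst_mem_ball hq)).1
    · exact fun q hq => ⟨(hball q hq).2.2, (hball _ (dropFirst_mem_ball hq)).2.1⟩
  refine ⟨ρ, hρ, fun q hq => (hball q hq).1, fun q => Φ (q 0) (ξ (dropFirst d q)), hF,
    fun q hq => ?_, fun q hq => ?_⟩
  · have hb := hball _ (dropFirst_mem_ball hq)
    have h1 := hasDerivAt_comp_add_smul (q := dropFirst d q) (t := q 0)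
      (e := (Pi.single 0 1 : Fin (d + 1) → ℝ))
      (u := fun q => Φ (q 0) (ξ (dropFirst d q))) (by
        rw [dropFirst_add_smul]
        exact (hF.contDiffAt (Metric.isOpen_ball.mem_nhds hq)).differentiableAt (by simp))
    rw [dropFirst_add_smul] at h1
    have h2 := (hflow _ hb.2.1).2 (q 0) (hball q hq).2.2
    refine h1.unique (h2.congr_of_eventuallyEq (Filter.Eventually.of_forall fun s => ?_))
    simp [dropFirst_add_smul_single, dropFirst_eq_self]
  · have hb := hball _ (dropFirst_mem_ball hq)
    simp only [dropFirst_apply_zero]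
    rw [dropFirst_eq_self (dropFirst_apply_zero q)]
    exact (hflow _ hb.2.1).1

/-- The dot product on `ℝⁿ` as a continuous bilinear map. -/
noncomputable def dotCLM (n : ℕ) : (Fin n → ℝ) →L[ℝ] (Fin n → ℝ) →L[ℝ] ℝ :=
  ∑ i, (ContinuousLinearMap.proj (R := ℝ) (φ := fun _ : Fin n => ℝ) i).smulRight
    (ContinuousLinearMap.proj (R := ℝ) (φ := fun _ : Fin n => ℝ) i)

lemma dotCLM_apply {n : ℕ} (p u : Fin n → ℝ) : dotCLM n p u = p ⬝ᵥ u := by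
  simp [dotCLM, dotProduct]

lemma ContinuousLinearMap.apply_eq_dotProduct {n : ℕ} (A : (Fin n → ℝ) →L[ℝ] ℝ)
    (u : Fin n → ℝ) : A u = (fun i => A (Pi.single i 1)) ⬝ᵥ u := by
  conv_lhs => rw [pi_eq_sum_univ' u, map_sum]
  refine Finset.sum_congr rfl fun i _ => ?_
  rw [map_smul, smul_eq_mul, mul_comm]

/-- The partial gradient of `h` in the momentum variables. -/
noncomputable def momentumGrad {n : ℕ} (h : (Fin n → ℝ) × (Fin n → ℝ) → ℝ)
    (x : (Fin n → ℝ) × (Fin n → ℝ)) : Fin n → ℝ :=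
  fun i => fderiv ℝ h x (0, Pi.single i 1)

/-- The partial gradient of `h` in the position variables. -/
noncomputable def positionGrad {n : ℕ} (h : (Fin n → ℝ) × (Fin n → ℝ) → ℝ)
    (x : (Fin n → ℝ) × (Fin n → ℝ)) : Fin n → ℝ :=
  fun i => fderiv ℝ h x (Pi.single i 1, 0)

lemma contDiff_momentumGrad {n : ℕ} {h : (Fin n → ℝ) × (Fin n → ℝ) → ℝ}
    (hh : ContDiff ℝ (⊤ : ℕ∞) h) : ContDiff ℝ (⊤ : ℕ∞) (momentumGrad h) :=
  contDiff_pi.2 fun _ => (hh.fderiv_right (by simp)).clm_apply contDiff_const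

lemma contDiff_positionGrad {n : ℕ} {h : (Fin n → ℝ) × (Fin n → ℝ) → ℝ}
    (hh : ContDiff ℝ (⊤ : ℕ∞) h) : ContDiff ℝ (⊤ : ℕ∞) (positionGrad h) :=
  contDiff_pi.2 fun _ => (hh.fderiv_right (by simp)).clm_apply contDiff_const

lemma fderiv_apply_eq_dotProduct {n : ℕ} (h : (Fin n → ℝ) × (Fin n → ℝ) → ℝ)
    (x : (Fin n → ℝ) × (Fin n → ℝ)) (u u' : Fin n → ℝ) :
    fderiv ℝ h x (u, u') = positionGrad h x ⬝ᵥ u + momentumGrad h x ⬝ᵥ u' := by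
  have h1 : ((u, u') : (Fin n → ℝ) × (Fin n → ℝ)) = (u, 0) + (0, u') := by simp
  rw [h1, map_add]
  congr 1
  · exact ((fderiv ℝ h x).comp (ContinuousLinearMap.inl ℝ _ _)).apply_eq_dotProduct u
  · exact ((fderiv ℝ h x).comp (ContinuousLinearMap.inr ℝ _ _)).apply_eq_dotProduct u'

lemma hasFDerivAt_dotProduct {X : Type*} [NormedAddCommGroup X] [NormedSpace ℝ X] {n : ℕ}
    {a b : X → Fin n → ℝ} {a' b' : X →L[ℝ] Fin n → ℝ} {x : X} (ha : HasFDerivAt a a' x)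
    (hb : HasFDerivAt b b' x) :
    ∃ c' : X →L[ℝ] ℝ, HasFDerivAt (fun y => a y ⬝ᵥ b y) c' x ∧
      ∀ u, c' u = a' u ⬝ᵥ b x + a x ⬝ᵥ b' u := by
  refine ⟨_, ((dotCLM n).hasFDerivAt_of_bilinear ha hb).congr_of_eventuallyEq
    (Filter.Eventually.of_forall fun y => (dotCLM_apply _ _).symm), fun u => ?_⟩
  simp [dotCLM_apply, add_comm]

lemma fderiv_fderiv_apply_comm {X Y : Type*} [NormedAddCommGroup X] [NormedSpace ℝ X]
    [NormedAddCommGroup Y] [NormedSpace ℝ Y] {G : X → Y} {x : X}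
    (hG : ContDiffAt ℝ (⊤ : ℕ∞) G x) (u v : X) :
    fderiv ℝ (fun y => fderiv ℝ G y u) x v = fderiv ℝ (fun y => fderiv ℝ G y v) x u := by
  have h1 : DifferentiableAt ℝ (fderiv ℝ G) x :=
    (hG.fderiv_right (m := (⊤ : ℕ∞)) (by simp)).differentiableAt (by simp)
  have h2 : ∀ w, fderiv ℝ (fun y => fderiv ℝ G y w) x = (fderiv ℝ (fderiv ℝ G) x).flip w := by
    intro w
    rw [fderiv_clm_apply h1 (differentiableAt_const w)]
    simp
  rw [h2, h2]
  exact hG.isSymmSndFDerivAt (by simpa using WithTop.coe_le_coe.2 (le_top : (2 : ℕ∞) ≤ ⊤)) v u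

/-- If `(X, p, z)` satisfies the characteristic equations of `h = const` in the direction `e`,
then the defect `dz - p dX` is constant along `e`. -/
lemma fderiv_contact_defect_eq_zero {n : ℕ} {E : Type*} [NormedAddCommGroup E]
    [NormedSpace ℝ E] {h : (Fin n → ℝ) × (Fin n → ℝ) → ℝ} (hh : ContDiff ℝ (⊤ : ℕ∞) h)
    {X p : E → Fin n → ℝ} {z : E → ℝ} {S : Set E} (hS : IsOpen S) {e : E}
    (hX : ContDiffOn ℝ (⊤ : ℕ∞) X S) (hp : ContDiffOn ℝ (⊤ : ℕ∞) p S)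
    (hz : ContDiffOn ℝ (⊤ : ℕ∞) z S)
    (hXe : ∀ q ∈ S, fderiv ℝ X q e = momentumGrad h (X q, p q))
    (hpe : ∀ q ∈ S, fderiv ℝ p q e = -positionGrad h (X q, p q))
    (hze : ∀ q ∈ S, fderiv ℝ z q e = p q ⬝ᵥ momentumGrad h (X q, p q))
    {k : ℝ} (hk : ∀ q ∈ S, h (X q, p q) = k) {q : E} (hq : q ∈ S) (u : E) :
    HasFDerivAt (fun y => fderiv ℝ z y u - p y ⬝ᵥ fderiv ℝ X y u)
      (fderiv ℝ (fun y => fderiv ℝ z y u - p y ⬝ᵥ fderiv ℝ X y u) q) q ∧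
    fderiv ℝ (fun y => fderiv ℝ z y u - p y ⬝ᵥ fderiv ℝ X y u) q e = 0 := by
  have hn := hS.mem_nhds hq
  have cX := hX.contDiffAt hn
  have cp := hp.contDiffAt hn
  have cz := hz.contDiffAt hn
  have dp := (cp.differentiableAt (by simp)).hasFDerivAt
  have dX := (cX.differentiableAt (by simp)).hasFDerivAt
  have dXu : ∀ w, HasFDerivAt (fun y => fderiv ℝ X y w)
      (fderiv ℝ (fun y => fderiv ℝ X y w) q) q := fun w =>
    (((cX.fderiv_right (m := (⊤ : ℕ∞)) (by simp)).differentiableAt (by simp)).clm_apply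
      (differentiableAt_const w)).hasFDerivAt
  have dzu : ∀ w, HasFDerivAt (fun y => fderiv ℝ z y w)
      (fderiv ℝ (fun y => fderiv ℝ z y w) q) q := fun w =>
    (((cz.fderiv_right (m := (⊤ : ℕ∞)) (by simp)).differentiableAt (by simp)).clm_apply
      (differentiableAt_const w)).hasFDerivAt
  obtain ⟨c, hc, hcu⟩ := hasFDerivAt_dotProduct dp (dXu u)
  obtain ⟨b, hb, hbu⟩ := hasFDerivAt_dotProduct dp (dXu e)
  have hD := (dzu u).sub hc
  refine ⟨hD.differentiableAt.hasFDerivAt, ?_⟩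
  have h1 : fderiv ℝ (fun y => fderiv ℝ z y e) q u = b u := by
    have : (fun y => fderiv ℝ z y e) =ᶠ[nhds q] fun y => p y ⬝ᵥ fderiv ℝ X y e := by
      filter_upwards [hn] with y hy
      rw [hze y hy, hXe y hy]
    rw [this.fderiv_eq, hb.fderiv]
  have h2 : fderiv ℝ h (X q, p q) (fderiv ℝ X q u, fderiv ℝ p q u) = 0 := by
    have h3 : HasFDerivAt (fun y => h (X y, p y))
        ((fderiv ℝ h (X q, p q)).comp ((fderiv ℝ X q).prod (fderiv ℝ p q))) q :=
      HasFDerivAt.comp (g := h) q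
        (hh.differentiable (by simp) (X q, p q)).hasFDerivAt (dX.prodMk dp)
    have h4 : (fun y => h (X y, p y)) =ᶠ[nhds q] fun _ => k := by
      filter_upwards [hn] with y hy using hk y hy
    have h5 := h3.fderiv.symm.trans (h4.fderiv_eq)
    have h6 := congrArg (fun A : E →L[ℝ] ℝ => A u) h5
    simpa using h6
  rw [fderiv_apply_eq_dotProduct] at h2
  change fderiv ℝ ((fun y => fderiv ℝ z y u) - fun y => p y ⬝ᵥ fderiv ℝ X y u) q e = 0
  rw [hD.fderiv, _root_.sub_apply, hcu, fderiv_fderiv_apply_comm cz, h1, hbu,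
    fderiv_fderiv_apply_comm cX u e, hXe q hq, hpe q hq, neg_dotProduct,
    dotProduct_comm (fderiv ℝ p q u)]
  linarith

/-- The method of characteristics for `h(x, dS(x)) = const`, in coordinates which straighten the
projected characteristics. -/
lemma exists_characteristic_coordinates {d : ℕ}
    {h : (Fin (d + 1) → ℝ) × (Fin (d + 1) → ℝ) → ℝ} (hh : ContDiff ℝ (⊤ : ℕ∞) h)
    (x₀ p₀ w : Fin (d + 1) → ℝ) (N : (Fin (d + 1) → ℝ) →L[ℝ] (Fin (d + 1) → ℝ))
    (hw : ∀ u, w ⬝ᵥ N u = u 0) (hN : N (Pi.single 0 1) = momentumGrad h (x₀, p₀)) :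
    ∃ ρ > 0, ∃ (X p : (Fin (d + 1) → ℝ) → (Fin (d + 1) → ℝ)) (z : (Fin (d + 1) → ℝ) → ℝ),
      ContDiffOn ℝ (⊤ : ℕ∞) X (Metric.ball 0 ρ) ∧ ContDiffOn ℝ (⊤ : ℕ∞) p (Metric.ball 0 ρ) ∧
      ContDiffOn ℝ (⊤ : ℕ∞) z (Metric.ball 0 ρ) ∧ X 0 = x₀ ∧ p 0 = p₀ ∧
      HasFDerivAt X N 0 ∧ ∀ q ∈ Metric.ball 0 ρ,
        fderiv ℝ X q (Pi.single 0 1) = momentumGrad h (X q, p q) ∧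
        fderiv ℝ p q (Pi.single 0 1) = -positionGrad h (X q, p q) ∧
        h (X q, p q) = h (x₀, p₀) ∧ ∀ u, fderiv ℝ z q u = p q ⬝ᵥ fderiv ℝ X q u := by
  let e₁ : Fin (d + 1) → ℝ := Pi.single 0 1
  have hwN : ∀ u, w ⬝ᵥ N (dropFirst d u) = 0 := fun u => by rw [hw, dropFirst_apply_zero]
  let G : (Fin (d + 1) → ℝ) × ℝ → ℝ := fun y => h (x₀ + N (dropFirst d y.1), p₀ + y.2 • w)
  have hG : ContDiff ℝ (⊤ : ℕ∞) G := hh.comp (by fun_prop)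
  have hG0 : G 0 = h (x₀, p₀) := by simp [G]
  have hG1 : fderiv ℝ G 0 (0, 1) = 1 := by
    have h1 : HasDerivAt (fun s : ℝ => ((0, s) : (Fin (d + 1) → ℝ) × ℝ)) (0, 1) 0 :=
      (hasDerivAt_const _ _).prodMk (hasDerivAt_id _)
    have h2 : HasDerivAt (fun s : ℝ => G (0, s)) (fderiv ℝ G 0 (0, 1)) 0 :=
      (hG.differentiable (by simp) (0, 0)).hasFDerivAt.comp_hasDerivAt 0 h1
    have h3 : HasDerivAt (fun s : ℝ => (x₀, p₀ + s • w)) ((0, w) : _ × (Fin (d + 1) → ℝ)) 0 :=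
      (hasDerivAt_const (0 : ℝ) x₀).prodMk
        (by simpa using ((hasDerivAt_id (0 : ℝ)).smul_const w).const_add p₀)
    have h4 : HasDerivAt (fun s : ℝ => h (x₀, p₀ + s • w)) (fderiv ℝ h (x₀, p₀) (0, w)) 0 := by
      refine HasFDerivAt.comp_hasDerivAt (l := h) (0 : ℝ) ?_ h3
      simpa using (hh.differentiable (by simp) (x₀, p₀)).hasFDerivAt
    rw [h2.unique (by simpa [G] using h4), fderiv_apply_eq_dotProduct, ← hN,
      dotProduct_comm _ w, hw]
    simp
  obtain ⟨U, σ, hU, h0U, hσ, hσ0, hGσ⟩ := exists_contDiffOn_implicit hG hG1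
  let Z := (Fin (d + 1) → ℝ) × (Fin (d + 1) → ℝ) × ℝ
  let f : Z → Z := fun y => (momentumGrad h (y.1, y.2.1), -positionGrad h (y.1, y.2.1),
    dotCLM (d + 1) y.2.1 (momentumGrad h (y.1, y.2.1)))
  have hpair : ContDiff ℝ (⊤ : ℕ∞) fun y : Z => (y.1, y.2.1) := by fun_prop
  have hm := (contDiff_momentumGrad hh).comp hpair
  have hf : ContDiff ℝ (⊤ : ℕ∞) f := hm.prodMk (((contDiff_positionGrad hh).comp hpair).neg.prodMk
    (((dotCLM (d + 1)).contDiff.comp (contDiff_fst.comp contDiff_snd)).clm_apply hm))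
  let ξ : (Fin (d + 1) → ℝ) → Z := fun q =>
    (x₀ + N (dropFirst d q), p₀ + σ q • w, dotCLM (d + 1) p₀ (N (dropFirst d q)))
  have hξ : ContDiffOn ℝ (⊤ : ℕ∞) ξ U := by
    refine ContDiffOn.prodMk (by fun_prop) (ContDiffOn.prodMk ?_ (by fun_prop))
    exact contDiffOn_const.add (hσ.smul contDiffOn_const)
  obtain ⟨ρ, hρ, hρU, F, hF, hFe, hFξ⟩ := exists_contDiffOn_flowout hf hU h0U hξ
  have hB : IsOpen (Metric.ball (0 : Fin (d + 1) → ℝ) ρ) := Metric.isOpen_ball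
  have h0B : (0 : Fin (d + 1) → ℝ) ∈ Metric.ball 0 ρ := Metric.mem_ball_self hρ
  let X := fun q => (F q).1
  let p := fun q => (F q).2.1
  let z := fun q => (F q).2.2
  have hX : ContDiffOn ℝ (⊤ : ℕ∞) X (Metric.ball 0 ρ) := contDiff_fst.comp_contDiffOn hF
  have hp : ContDiffOn ℝ (⊤ : ℕ∞) p (Metric.ball 0 ρ) :=
    (contDiff_fst.comp contDiff_snd).comp_contDiffOn hF
  have hz : ContDiffOn ℝ (⊤ : ℕ∞) z (Metric.ball 0 ρ) :=
    (contDiff_snd.comp contDiff_snd).comp_contDiffOn hF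
  have hdiff : ∀ {W : Type} [NormedAddCommGroup W] [NormedSpace ℝ W]
      {u : (Fin (d + 1) → ℝ) → W}, ContDiffOn ℝ (⊤ : ℕ∞) u (Metric.ball 0 ρ) →
      ∀ q ∈ Metric.ball 0 ρ, HasFDerivAt u (fderiv ℝ u q) q := fun hu q hq =>
    ((hu.contDiffAt (hB.mem_nhds hq)).differentiableAt (by simp)).hasFDerivAt
  have hXe : ∀ q ∈ Metric.ball 0 ρ, fderiv ℝ X q e₁ = momentumGrad h (X q, p q) := by
    intro q hq
    rw [(hdiff hF q hq).fst.fderiv]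
    exact congrArg Prod.fst (hFe q hq)
  have hpe : ∀ q ∈ Metric.ball 0 ρ, fderiv ℝ p q e₁ = -positionGrad h (X q, p q) := by
    intro q hq
    rw [(hdiff hF q hq).snd.fst.fderiv]
    exact congrArg (fun y : Z => y.2.1) (hFe q hq)
  have hze : ∀ q ∈ Metric.ball 0 ρ, fderiv ℝ z q e₁ = p q ⬝ᵥ momentumGrad h (X q, p q) := by
    intro q hq
    rw [(hdiff hF q hq).snd.snd.fderiv, ← dotCLM_apply]
    exact congrArg (fun y : Z => y.2.2) (hFe q hq)
  have hXs : ∀ q ∈ Metric.ball 0 ρ, X (dropFirst d q) = x₀ + N (dropFirst d q) := by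
    intro q hq
    simpa [ξ, dropFirst_eq_self] using congrArg Prod.fst (hFξ q hq)
  have hps : ∀ q ∈ Metric.ball 0 ρ, p (dropFirst d q) = p₀ + σ (dropFirst d q) • w := by
    intro q hq
    exact congrArg (fun y : Z => y.2.1) (hFξ q hq)
  have hzs : ∀ q ∈ Metric.ball 0 ρ, z (dropFirst d q) = dotCLM (d + 1) p₀ (N (dropFirst d q)) := by
    intro q hq
    simpa [ξ, dropFirst_eq_self] using congrArg (fun y : Z => y.2.2) (hFξ q hq)
  have hk : ∀ q ∈ Metric.ball 0 ρ, h (X q, p q) = h (x₀, p₀) := by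
    intro q hq
    have h1 : ∀ q ∈ Metric.ball 0 ρ, HasFDerivAt (fun y => h (X y, p y))
        ((fderiv ℝ h (X q, p q)).comp ((fderiv ℝ X q).prod (fderiv ℝ p q))) q := fun q hq =>
      HasFDerivAt.comp (g := h) q (hh.differentiable (by simp) (X q, p q)).hasFDerivAt
        ((hdiff hX q hq).prodMk (hdiff hp q hq))
    rw [eq_comp_dropFirst_of_fderiv_eq_zero (u := fun y => h (X y, p y))
      (fun y hy => (h1 y hy).differentiableAt.differentiableWithinAt) (fun y hy => ?_) hq]
    · have h2 := hGσ _ (hρU (dropFirst_mem_ball hq))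
      rw [hG0] at h2
      simpa [hXs q hq, hps q hq, G, dropFirst_eq_self] using h2
    · rw [(h1 y hy).fderiv]
      change fderiv ℝ h (X y, p y) (fderiv ℝ X y e₁, fderiv ℝ p y e₁) = 0
      rw [fderiv_apply_eq_dotProduct, hXe y hy, hpe y hy, dotProduct_neg, dotProduct_comm]
      ring
  have hslice : ∀ {W : Type} [NormedAddCommGroup W] [NormedSpace ℝ W]
      {u : (Fin (d + 1) → ℝ) → W} (c : W) (A : (Fin (d + 1) → ℝ) →L[ℝ] W),
      ContDiffOn ℝ (⊤ : ℕ∞) u (Metric.ball 0 ρ) →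
      (∀ q ∈ Metric.ball 0 ρ, u (dropFirst d q) = c + A (dropFirst d q)) →
      ∀ q ∈ Metric.ball 0 ρ, ∀ v,
        fderiv ℝ u (dropFirst d q) (dropFirst d v) = A (dropFirst d v) := by
    intro W _ _ u c A hu hus q hq v
    have h1 : HasFDerivAt (fun y => u (dropFirst d y))
        ((fderiv ℝ u (dropFirst d q)).comp (dropFirst d)) q :=
      HasFDerivAt.comp (g := u) q (hdiff hu _ (dropFirst_mem_ball hq)) (dropFirst d).hasFDerivAt
    have h2 : HasFDerivAt (fun y => u (dropFirst d y)) (A.comp (dropFirst d)) q := by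
      refine ((A.comp (dropFirst d)).hasFDerivAt.const_add c).congr_of_eventuallyEq ?_
      filter_upwards [hB.mem_nhds hq] with y hy using hus y hy
    exact congrArg (fun B : (Fin (d + 1) → ℝ) →L[ℝ] W => B v) (h1.unique h2)
  have hXslice := hslice x₀ N hX hXs
  have hzslice := hslice 0 ((dotCLM (d + 1) p₀).comp N) hz fun q hq => by simp [hzs q hq]
  have hX0 : X 0 = x₀ := by simpa using hXs 0 h0B
  have hp0 : p 0 = p₀ := by simpa [hσ0] using hps 0 h0B
  refine ⟨ρ, hρ, X, p, z, hX, hp, hz, hX0, hp0, ?_,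
    fun q hq => ⟨hXe q hq, hpe q hq, hk q hq, fun u => ?_⟩⟩
  · refine (hdiff hX 0 h0B).congr_fderiv (ContinuousLinearMap.ext fun u => ?_)
    have h1 := hXslice 0 h0B u
    rw [map_zero] at h1
    rw [← dropFirst_add_smul u, map_add, map_add, h1, map_smul, map_smul, hXe 0 h0B, hX0, hp0, hN]
  · have h1 := eq_comp_dropFirst_of_fderiv_eq_zero
      (u := fun y => fderiv ℝ z y u - p y ⬝ᵥ fderiv ℝ X y u)
      (fun y hy => (fderiv_contact_defect_eq_zero hh hB hX hp hz hXe hpe hze hk hy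
        u).1.differentiableAt.differentiableWithinAt)
      (fun y hy => (fderiv_contact_defect_eq_zero hh hB hX hp hz hXe hpe hze hk hy u).2) hq
    have hq' := dropFirst_mem_ball hq
    have h2 := hXslice q hq u
    have h3 := hzslice q hq u
    have h4 : fderiv ℝ z (dropFirst d q) u =
        p (dropFirst d q) ⬝ᵥ fderiv ℝ X (dropFirst d q) u := by
      rw [← dropFirst_add_smul u, map_add, map_add, h2, h3, map_smul, map_smul, hXe _ hq',
        hze _ hq', dotProduct_add, dotProduct_smul, hps q hq, add_dotProduct _ _ (N _),
        smul_dotProduct, hwN, ContinuousLinearMap.comp_apply, dotCLM_apply]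
      simp
    rw [h4, sub_self] at h1
    exact sub_eq_zero.1 h1

/-- Local forward uniqueness for solutions of a `C^1` ordinary differential equation. -/
lemma exists_eqOn_Icc_of_hasDerivAt {E : Type*} [NormedAddCommGroup E] [NormedSpace ℝ E]
    {f : E → E} {α β : ℝ → E} {T : ℝ} (hT : 0 < T) (hf : ContDiffAt ℝ 1 f (α 0))
    (hα : ∀ t ∈ Set.Icc 0 T, HasDerivAt α (f (α t)) t)
    (hβ : ∀ t ∈ Set.Icc 0 T, HasDerivAt β (f (β t)) t) (h0 : α 0 = β 0) :
    ∃ δ, 0 < δ ∧ δ ≤ T ∧ Set.EqOn α β (Set.Icc 0 δ) := by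
  obtain ⟨K, S, hS, hK⟩ := hf.exists_lipschitzOnWith
  have h0T : (0 : ℝ) ∈ Set.Icc 0 T := Set.left_mem_Icc.2 hT.le
  have hα0 : ∀ᶠ t in nhds 0, α t ∈ S := (hα 0 h0T).continuousAt.eventually hS
  have hβ0 : ∀ᶠ t in nhds 0, β t ∈ S := (hβ 0 h0T).continuousAt.eventually (h0 ▸ hS)
  obtain ⟨r, hr, hball⟩ := Metric.eventually_nhds_iff_ball.1 (hα0.and hβ0)
  have hsub : ∀ t ∈ Set.Icc 0 (min T (r / 2)), t ∈ Set.Icc 0 T ∧ t ∈ Metric.ball 0 r := by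
    intro t ht
    have h1 := ht.2.trans (min_le_left _ _)
    have h2 := ht.2.trans (min_le_right _ _)
    refine ⟨⟨ht.1, h1⟩, ?_⟩
    rw [mem_ball_zero_iff, Real.norm_of_nonneg ht.1]
    linarith
  have hsub' : ∀ t ∈ Set.Ico 0 (min T (r / 2)), t ∈ Set.Icc 0 T ∧ t ∈ Metric.ball 0 r :=
    fun t ht => hsub t (Set.Ico_subset_Icc_self ht)
  refine ⟨min T (r / 2), by positivity, min_le_left _ _,
    ODE_solution_unique_of_mem_Icc_right (v := fun _ => f) (s := fun _ => S) (fun _ _ => hK)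
      (HasDerivAt.continuousOn fun t ht => hα t (hsub t ht).1)
      (fun t ht => (hα t (hsub' t ht).1).hasDerivWithinAt) (fun t ht => (hball t (hsub' t ht).2).1)
      (HasDerivAt.continuousOn fun t ht => hβ t (hsub t ht).1)
      (fun t ht => (hβ t (hsub' t ht).1).hasDerivWithinAt) (fun t ht => (hball t (hsub' t ht).2).2)
      h0⟩

lemma fderiv_fderiv_comp_affine {X Y : Type*} [NormedAddCommGroup X] [NormedSpace ℝ X]
    [NormedAddCommGroup Y] [NormedSpace ℝ Y] {f : Y → ℝ} (hf : ContDiff ℝ (⊤ : ℕ∞) f)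
    (B : X →L[ℝ] Y) (c : Y) (x u u' : X) :
    fderiv ℝ (fun x => fderiv ℝ (fun y => f (B y + c)) x u) x u' =
      fderiv ℝ (fderiv ℝ f) (B x + c) (B u') (B u) := by
  have hB : ∀ x, HasFDerivAt (fun y => B y + c) B x := fun x => B.hasFDerivAt.add_const c
  have h1 : (fun x => fderiv ℝ (fun y => f (B y + c)) x u) =
      fun x => fderiv ℝ f (B x + c) (B u) := by
    ext x
    have := HasFDerivAt.comp (g := f) x (hf.differentiable (by simp) (B x + c)).hasFDerivAt (hB x)
    exact congrArg (fun A : X →L[ℝ] ℝ => A u) this.fderiv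
  have h2 : HasFDerivAt (fderiv ℝ f) (fderiv ℝ (fderiv ℝ f) (B x + c)) (B x + c) :=
    ((hf.fderiv_right (m := (⊤ : ℕ∞)) (by simp)).differentiable (by simp) _).hasFDerivAt
  have h3 := (HasFDerivAt.comp (g := fderiv ℝ f) x h2 (hB x)).clm_apply
    (hasFDerivAt_const (B u) x)
  rw [h1]
  have h4 := congrArg (fun A : X →L[ℝ] ℝ => A u') h3.fderiv
  simpa using h4

lemma fderiv_fderiv_eq_dotProduct_mulVec {n : ℕ} {f : (Fin n → ℝ) → ℝ}
    (hf : ContDiff ℝ (⊤ : ℕ∞) f) (c u u' : Fin n → ℝ) :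
    fderiv ℝ (fderiv ℝ f) c u' u = u ⬝ᵥ (Matrix.of fun i j =>
      fderiv ℝ (fun y => fderiv ℝ f y (Pi.single i 1)) c (Pi.single j 1)) *ᵥ u' := by
  have h1 : ∀ v v', fderiv ℝ (fun y => fderiv ℝ f y v) c v' = fderiv ℝ (fderiv ℝ f) c v' v := by
    intro v v'
    simpa using fderiv_fderiv_comp_affine hf (ContinuousLinearMap.id ℝ _) 0 c v v'
  simp only [h1]
  rw [(fderiv ℝ (fderiv ℝ f) c u').apply_eq_dotProduct u, dotProduct_comm]
  congr 1
  ext i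
  exact ((fderiv ℝ (fderiv ℝ f) c).flip (Pi.single i 1)).apply_eq_dotProduct u'

lemma fderiv_partial_momentum {n : ℕ} {H : (Fin n → ℝ) → (Fin n → ℝ) → ℝ}
    (hH : ContDiff ℝ (⊤ : ℕ∞) fun x : (Fin n → ℝ) × (Fin n → ℝ) => H x.1 x.2)
    (q p : Fin n → ℝ) (i : Fin n) :
    fderiv ℝ (H q) p (Pi.single i 1) =
      momentumGrad (fun x : (Fin n → ℝ) × (Fin n → ℝ) => H x.1 x.2) (q, p) i :=
  congrArg (fun A : (Fin n → ℝ) →L[ℝ] ℝ => A (Pi.single i 1))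
    (HasFDerivAt.comp (g := fun x : (Fin n → ℝ) × (Fin n → ℝ) => H x.1 x.2) p
      (hH.differentiable (by simp) (q, p)).hasFDerivAt (hasFDerivAt_prodMk_right q p)).fderiv

lemma fderiv_partial_position {n : ℕ} {H : (Fin n → ℝ) → (Fin n → ℝ) → ℝ}
    (hH : ContDiff ℝ (⊤ : ℕ∞) fun x : (Fin n → ℝ) × (Fin n → ℝ) => H x.1 x.2)
    (q p : Fin n → ℝ) (i : Fin n) :
    fderiv ℝ (fun q' => H q' p) q (Pi.single i 1) =
      positionGrad (fun x : (Fin n → ℝ) × (Fin n → ℝ) => H x.1 x.2) (q, p) i :=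
  congrArg (fun A : (Fin n → ℝ) →L[ℝ] ℝ => A (Pi.single i 1))
    (HasFDerivAt.comp (g := fun x : (Fin n → ℝ) × (Fin n → ℝ) => H x.1 x.2)
      (f := fun q' => (q', p)) q
      (hH.differentiable (by simp) (q, p)).hasFDerivAt (hasFDerivAt_prodMk_left q p)).fderiv

lemma transpose_of_mulVec_single {n : ℕ} (A : (Fin n → ℝ) →L[ℝ] (Fin n → ℝ)) (y : Fin n → ℝ) :
    (Matrix.of fun i j => A (Pi.single j 1) i)ᵀ *ᵥ y = fun j => y ⬝ᵥ A (Pi.single j 1) := by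
  ext j
  exact dotProduct_comm _ _

lemma of_mulVec_eq {n : ℕ} (A : (Fin n → ℝ) →L[ℝ] (Fin n → ℝ)) (y : Fin n → ℝ) :
    (Matrix.of fun i j => A (Pi.single j 1) i) *ᵥ y = A y := by
  ext i
  exact (((ContinuousLinearMap.proj (R := ℝ) (φ := fun _ : Fin n => ℝ) i).comp
    A).apply_eq_dotProduct y).symm

/-- Normal form along an orbit segment: for a smooth Hamiltonian `H` on
`ℝ^{d+1} × ℝ^{d+1}`, an orbit `θ = (Q,P)` of Hamilton's equations on `[0,T]` with energy
`k`, `Q̇(0) ≠ 0`, and `∂²_{pp}H(θ(0))` positive semidefinite, there exist `δ ∈ (0,T]`,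
neighborhoods `V ∋ Q(0)` and `Ṽ ∋ 0`, a smooth diffeomorphism `φ : V → Ṽ` with
`φ(Q(0)) = 0`, and a smooth `g : Ṽ → ℝ`, such that the transformed Hamiltonian
`H̃(q,p) = H(φ⁻¹(q), (Dφ(φ⁻¹(q)))ᵀ(p + ∇g(q)))` satisfies:
(a) `φ(Q(t)) = t e₁` and `(Dφ(Q(t)))ᵀ ∇g(t e₁) = P(t)` on `[0,δ]`;
(b) `H̃(q,0) = k` on `Ṽ`; (c) `∂_p H̃(q,0) = e₁` on `Ṽ`;
(d) `∂²_{p̂p̂} H̃(0,0) = fromBlocks(I_r,0,0,0)` for some `0 ≤ r ≤ d`. -/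
theorem stmt15 {d : ℕ} (hd : 1 ≤ d) (T k : ℝ) (hT : 0 < T)
    (H : (Fin (d + 1) → ℝ) → (Fin (d + 1) → ℝ) → ℝ)
    (hH : ContDiff ℝ (⊤ : ℕ∞) (fun x : (Fin (d + 1) → ℝ) × (Fin (d + 1) → ℝ) => H x.1 x.2))
    (Q P : ℝ → (Fin (d + 1) → ℝ))
    (hQ : ∀ t ∈ Set.Icc (0 : ℝ) T, ∀ i, HasDerivAt (fun s : ℝ => Q s i)
        (fderiv ℝ (fun p' => H (Q t) p') (P t) (Pi.single i 1)) t)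
    (hP : ∀ t ∈ Set.Icc (0 : ℝ) T, ∀ i, HasDerivAt (fun s : ℝ => P s i)
        (-(fderiv ℝ (fun q' => H q' (P t)) (Q t) (Pi.single i 1))) t)
    (henergy : ∀ t ∈ Set.Icc (0 : ℝ) T, H (Q t) (P t) = k)
    (hQ0 : (fun i => deriv (fun s : ℝ => Q s i) 0) ≠ (0 : Fin (d + 1) → ℝ))
    (hhess : Matrix.PosSemidef (Matrix.of fun i j =>
        fderiv ℝ (fun p' => fderiv ℝ (H (Q 0)) p' (Pi.single i 1)) (P 0) (Pi.single j 1))) :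
    ∃ δ : ℝ, 0 < δ ∧ δ ≤ T ∧
    ∃ V Vt : Set (Fin (d + 1) → ℝ), IsOpen V ∧ IsOpen Vt ∧ Q 0 ∈ V ∧ (0 : Fin (d+1) → ℝ) ∈ Vt ∧
    ∃ φ ψ : (Fin (d + 1) → ℝ) → (Fin (d + 1) → ℝ),
      ContDiffOn ℝ (⊤ : ℕ∞) φ V ∧ ContDiffOn ℝ (⊤ : ℕ∞) ψ Vt ∧
      Set.BijOn φ V Vt ∧ (∀ x ∈ V, ψ (φ x) = x) ∧ φ (Q 0) = 0 ∧
    ∃ g : (Fin (d + 1) → ℝ) → ℝ, ContDiffOn ℝ (⊤ : ℕ∞) g Vt ∧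
      (let e₁ : Fin (d + 1) → ℝ := Pi.single 0 1
       let J : (Fin (d + 1) → ℝ) → Matrix (Fin (d + 1)) (Fin (d + 1)) ℝ :=
         fun x => Matrix.of fun i j => fderiv ℝ φ x (Pi.single j 1) i
       let Ht : (Fin (d + 1) → ℝ) → (Fin (d + 1) → ℝ) → ℝ :=
         fun q p => H (ψ q) ((J (ψ q))ᵀ *ᵥ (p + grad g q))
       (∀ t ∈ Set.Icc 0 δ, φ (Q t) = t • e₁ ∧ (J (Q t))ᵀ *ᵥ grad g (t • e₁) = P t) ∧
       (∀ q ∈ Vt, Ht q 0 = k) ∧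
       (∀ q ∈ Vt, grad (Ht q) 0 = e₁) ∧
       (∃ r : ℕ, r ≤ d ∧ ∀ a b : Fin d,
          fderiv ℝ (fun p' => fderiv ℝ (Ht 0) p' (Pi.single a.succ 1)) 0 (Pi.single b.succ 1)
            = if a = b ∧ (a : ℕ) < r then 1 else 0)) := by
  have h0T : (0 : ℝ) ∈ Set.Icc 0 T := Set.left_mem_Icc.2 hT.le
  let h : (Fin (d + 1) → ℝ) × (Fin (d + 1) → ℝ) → ℝ := fun x => H x.1 x.2
  have hQ' : ∀ t ∈ Set.Icc 0 T, HasDerivAt Q (momentumGrad h (Q t, P t)) t := fun t ht =>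
    hasDerivAt_pi.2 fun i => fderiv_partial_momentum hH (Q t) (P t) i ▸ hQ t ht i
  have hP' : ∀ t ∈ Set.Icc 0 T, HasDerivAt P (-positionGrad h (Q t, P t)) t := fun t ht =>
    hasDerivAt_pi.2 fun i => by simpa [fderiv_partial_position hH] using hP t ht i
  have hv : momentumGrad h (Q 0, P 0) ≠ 0 := by
    intro hv
    refine hQ0 (funext fun i => ?_)
    rw [(hasDerivAt_pi.1 (hQ' 0 h0T) i).deriv, hv]
  obtain ⟨L, M, hLM, hML, hLv, r, hr, hdiag⟩ := exists_adapted_frame hhess hv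
  let N : (Fin (d + 1) → ℝ) →L[ℝ] (Fin (d + 1) → ℝ) := M.mulVecLin.toContinuousLinearMap
  let N' : (Fin (d + 1) → ℝ) →L[ℝ] (Fin (d + 1) → ℝ) := L.mulVecLin.toContinuousLinearMap
  have hN'N : ∀ u, N' (N u) = u := fun u => by simp [N, N', hLM]
  have hNN' : ∀ u, N (N' u) = u := fun u => by simp [N, N', hML]
  obtain ⟨ρ, hρ, X, p, z, hX, hp, hz, hX0, hp0, hDX, hchar⟩ :=
    exists_characteristic_coordinates hH (Q 0) (P 0) (L 0) N
      (fun u => congrFun (hN'N u) 0) (by rw [← hLv]; exact hNN' _)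
  obtain ⟨e, h0e, heρ, heX, hesymm⟩ := exists_openPartialHomeomorph_contDiffOn_symm
    Metric.isOpen_ball (Metric.mem_ball_self hρ) hX
    (F' := ContinuousLinearEquiv.equivOfInverse N N' hN'N hNN') hDX
  have hDe : ∀ q ∈ e.source, HasFDerivAt X (fderiv ℝ X q) q ∧
      HasFDerivAt e.symm (fderiv ℝ e.symm (X q)) (X q) ∧
      (∀ u, fderiv ℝ e.symm (X q) (fderiv ℝ X q u) = u) ∧
      ∀ u, fderiv ℝ X q (fderiv ℝ e.symm (X q) u) = u := by
    intro q hq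
    have hXq : X q ∈ e.target := heX q ▸ e.map_source hq
    have h1 := ((hX.contDiffAt (Metric.isOpen_ball.mem_nhds (heρ hq))).differentiableAt
      (by simp)).hasFDerivAt
    have h2 := ((hesymm.contDiffAt (e.open_target.mem_nhds hXq)).differentiableAt
      (by simp)).hasFDerivAt
    have hinv : e.symm (X q) = q := by rw [← heX, e.left_inv hq]
    refine ⟨h1, h2, fun u => ?_, fun u => ?_⟩
    · have h3 : (fun y => e.symm (X y)) =ᶠ[nhds q] id := by
        filter_upwards [e.open_source.mem_nhds hq] with y hy
        rw [← heX, e.left_inv hy, id]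
      exact congrArg (fun A : (Fin (d + 1) → ℝ) →L[ℝ] (Fin (d + 1) → ℝ) => A u)
        ((HasFDerivAt.comp (g := e.symm) q h2 h1).unique
          ((hasFDerivAt_id q).congr_of_eventuallyEq h3))
    · have h3 : (fun y => X (e.symm y)) =ᶠ[nhds (X q)] id := by
        filter_upwards [e.open_target.mem_nhds hXq] with y hy
        rw [← heX, e.right_inv hy, id]
      have h4 : HasFDerivAt X (fderiv ℝ X q) (e.symm (X q)) := by rwa [hinv]
      exact congrArg (fun A : (Fin (d + 1) → ℝ) →L[ℝ] (Fin (d + 1) → ℝ) => A u)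
        ((HasFDerivAt.comp (g := X) (X q) h4 h2).unique
          ((hasFDerivAt_id (X q)).congr_of_eventuallyEq h3))
  have hgrad : ∀ q ∈ e.source,
      (Matrix.of fun i j => fderiv ℝ e.symm (X q) (Pi.single j 1) i)ᵀ *ᵥ grad z q = p q := by
    intro q hq
    rw [transpose_of_mulVec_single]
    ext j
    have h1 : grad z q ⬝ᵥ fderiv ℝ e.symm (X q) (Pi.single j 1) =
        fderiv ℝ z q (fderiv ℝ e.symm (X q) (Pi.single j 1)) :=
      ((fderiv ℝ z q).apply_eq_dotProduct _).symm
    rw [h1, (hchar q (heρ hq)).2.2.2, (hDe q hq).2.2.2, dotProduct_single_one]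
  let e₁ : Fin (d + 1) → ℝ := Pi.single 0 1
  have hline : ContinuousAt (fun t : ℝ => t • e₁) 0 := by fun_prop
  obtain ⟨τ, hτ, hτe⟩ := Metric.eventually_nhds_iff_ball.1
    (hline.eventually (e.open_source.mem_nhds (by simpa using h0e)))
  let T' := min T (τ / 2)
  have hT' : ∀ t ∈ Set.Icc 0 T', t ∈ Set.Icc 0 T ∧ t • e₁ ∈ e.source := by
    intro t ht
    refine ⟨⟨ht.1, ht.2.trans (min_le_left _ _)⟩, hτe t ?_⟩
    rw [mem_ball_zero_iff, Real.norm_of_nonneg ht.1]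
    linarith [ht.2.trans (min_le_right _ _)]
  obtain ⟨δ, hδ, hδT, heq⟩ := exists_eqOn_Icc_of_hasDerivAt (T := T')
    (f := fun x => (momentumGrad h x, -positionGrad h x))
    (α := fun t => (Q t, P t)) (β := fun t => (X (t • e₁), p (t • e₁))) (by positivity)
    (((contDiff_momentumGrad hH).prodMk (contDiff_positionGrad hH).neg).of_le
      (by simp)).contDiffAt
    (fun t ht => (hQ' t (hT' t ht).1).prodMk (hP' t (hT' t ht).1))
    (fun t ht => by
      have hm := heρ (hT' t ht).2
      have hn := Metric.isOpen_ball.mem_nhds hm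
      have h1 := hasDerivAt_comp_add_smul (q := 0) (t := t) (e := e₁) (u := X)
        (by simpa using (hX.contDiffAt hn).differentiableAt (by simp))
      have h2 := hasDerivAt_comp_add_smul (q := 0) (t := t) (e := e₁) (u := p)
        (by simpa using (hp.contDiffAt hn).differentiableAt (by simp))
      simp only [zero_add] at h1 h2
      rw [(hchar _ hm).1] at h1
      rw [(hchar _ hm).2.1] at h2
      exact h1.prodMk h2)
    (by simp [hX0, hp0])
  have hXtar : ∀ q ∈ e.source, X q ∈ e.target := fun q hq => heX q ▸ e.map_source hq
  have hleft : ∀ q ∈ e.source, e.symm (X q) = q := fun q hq => by rw [← heX, e.left_inv hq]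
  have hHt : ∀ q ∈ e.source, ∀ y,
      H (X q) ((Matrix.of fun i j => fderiv ℝ e.symm (X q) (Pi.single j 1) i)ᵀ *ᵥ
        (y + grad z q)) =
      h (X q, (Matrix.of fun i j => fderiv ℝ e.symm (X q) (Pi.single j 1) i)ᵀ *ᵥ y + p q) := by
    intro q hq y
    rw [mulVec_add, hgrad q hq]
  have hk : h (Q 0, P 0) = k := henergy 0 h0T
  refine ⟨δ, hδ, hδT.trans (min_le_left _ _), e.target, e.source, e.open_target, e.open_source,
    hX0 ▸ hXtar 0 h0e, h0e, e.symm, X, hesymm, hX.mono heρ, e.symm.bijOn, fun x hx => ?_, ?_, z,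
    hz.mono heρ, fun t ht => ?_, fun q hq => ?_, fun q hq => ?_, r, hr, fun a b => ?_⟩
  · rw [← heX, e.right_inv hx]
  · rw [← hX0, hleft 0 h0e]
  · have hm := (hT' t ⟨ht.1, ht.2.trans hδT⟩).2
    have h1 : Q t = X (t • e₁) := congrArg Prod.fst (heq ht)
    have h2 : P t = p (t • e₁) := congrArg Prod.snd (heq ht)
    rw [h1, h2]
    exact ⟨hleft _ hm, hgrad _ hm⟩
  · refine (hHt q hq 0).trans ?_
    rw [mulVec_zero, zero_add]
    exact (hchar q (heρ hq)).2.2.1.trans hk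
  · let B := (Matrix.of fun i j => fderiv ℝ e.symm (X q) (Pi.single j 1) i)ᵀ
    have h1 : HasFDerivAt (fun y => h (X q, B.mulVecLin.toContinuousLinearMap y + p q))
        ((fderiv ℝ h (X q, p q)).comp
          ((0 : (Fin (d + 1) → ℝ) →L[ℝ] (Fin (d + 1) → ℝ)).prod
            B.mulVecLin.toContinuousLinearMap)) 0 := by
      refine HasFDerivAt.comp (g := h) 0 ?_ ((hasFDerivAt_const _ _).prodMk
        (B.mulVecLin.toContinuousLinearMap.hasFDerivAt.add_const _))
      simpa using (hH.differentiable (by simp) (X q, p q)).hasFDerivAt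
    ext i
    change fderiv ℝ (fun y => H (X q) (B *ᵥ (y + grad z q))) 0 (Pi.single i 1) = e₁ i
    rw [funext (hHt q hq)]
    refine (congrArg (fun A : (Fin (d + 1) → ℝ) →L[ℝ] ℝ => A (Pi.single i 1)) h1.fderiv).trans ?_
    change fderiv ℝ h (X q, p q) (0, B *ᵥ Pi.single i 1) = e₁ i
    rw [fderiv_apply_eq_dotProduct, dotProduct_zero, zero_add, dotProduct_mulVec,
      vecMul_transpose, dotProduct_single_one, of_mulVec_eq, ← (hchar q (heρ hq)).1,
      (hDe q hq).2.2.1]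
  · have hJ : (Matrix.of fun i j => fderiv ℝ e.symm (X 0) (Pi.single j 1) i) = L := by
      refine Matrix.ext_of_mulVec_single fun j => ?_
      rw [of_mulVec_eq]
      conv_lhs => rw [← hNN' (Pi.single j 1)]
      rw [← hDX.fderiv, (hDe 0 h0e).2.2.1]
      rfl
    have hf : ContDiff ℝ (⊤ : ℕ∞) (H (Q 0)) := hH.comp (contDiff_prodMk_right (Q 0))
    have hK : (fun y => H (X 0)
        ((Matrix.of fun i j => fderiv ℝ e.symm (X 0) (Pi.single j 1) i)ᵀ *ᵥ (y + grad z 0))) =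
        fun y => H (Q 0) (Lᵀ.mulVecLin.toContinuousLinearMap y + P 0) := by
      ext y
      rw [hHt 0 h0e, hJ, hX0, hp0]
      rfl
    dsimp only
    rw [hK, fderiv_fderiv_comp_affine hf, map_zero, zero_add,
      fderiv_fderiv_eq_dotProduct_mulVec hf, ← hdiag a b]
    change (Lᵀ *ᵥ Pi.single a.succ 1) ⬝ᵥ _ *ᵥ (Lᵀ *ᵥ Pi.single b.succ 1) = _
    rw [mulVec_mulVec, mulVec_transpose, ← dotProduct_mulVec, mulVec_mulVec, ← Matrix.mul_assoc]
    simp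
end
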